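/- arXiv:0810.4569 — 3 statements merged into one kernel-verified Lean document; each statement's English description precedes it below -/
import Mathlib

section
/- Let A be a finite-dimensional ℚ-algebra with the hyperbolic property and let I be a proper two-sided ideal of A. Then the quotient algebra A/I also has the hyperbolic property. -/
/-- A `ℤ`-order in a finite-dimensional `ℚ`-algebra `A`. -/
def IsZOrder (A : Type*) [Ring A] [Algebra ℚ A] (Γ : Subring A) : Prop :=
  Γ.toAddSubgroup.FG ∧ Submodule.span ℚ (Γ : Set A) = ⊤

/-- A group `G` contains a subgroup isomorphic to `ℤ × ℤ`. -/
def HasZxZ (G : Type*) [Group G] : Prop :=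
  ∃ f : Multiplicative (ℤ × ℤ) →* G, Function.Injective f

/-- The hyperbolic property: no `ℤ`-order of `A` has a unit group containing `ℤ × ℤ`. -/
def HasHyperbolicProperty (A : Type*) [Ring A] [Algebra ℚ A] : Prop :=
  ∀ Γ : Subring A, IsZOrder A Γ → ¬ HasZxZ Γˣ

/-- The `ℚ`-algebra structure on the quotient of a `ℚ`-algebra by a two-sided ideal. -/
noncomputable instance quotAlgebra {A : Type*} [Ring A] [Algebra ℚ A]
    (I : TwoSidedIdeal A) : Algebra ℚ I.ringCon.Quotient :=
  RingHom.toAlgebra'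
    ((I.ringCon.mk' : A →+* I.ringCon.Quotient).comp (algebraMap ℚ A))
    (fun q x => Quotient.inductionOn' x fun a => by
      show (I.ringCon.mk' (algebraMap ℚ A q)) * I.ringCon.mk' a
          = I.ringCon.mk' a * I.ringCon.mk' (algebraMap ℚ A q)
      rw [← map_mul, ← map_mul, Algebra.commutes])

set_option linter.style.haveILetI false
set_option linter.deprecated false
set_option linter.unusedSectionVars false

/-- integral with integral inverse -/
def IntUnit {A : Type*} [Ring A] (u : Aˣ) : Prop :=
  IsIntegral ℤ (u : A) ∧ IsIntegral ℤ ((u⁻¹ : Aˣ) : A)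

/-- multiplicative independence -/
def MulIndep {G : Type*} [Group G] (u v : G) : Prop :=
  ∀ n m : ℤ, u ^ n * v ^ m = 1 → n = 0 ∧ m = 0

/-- two commuting independent integral units -/
def HasPair (A : Type*) [Ring A] : Prop :=
  ∃ u v : Aˣ, Commute u v ∧ IntUnit u ∧ IntUnit v ∧ MulIndep u v

theorem MulIndep.symm {G : Type*} [Group G] {u v : G} (hc : Commute u v) (h : MulIndep u v) :
    MulIndep v u := by
  intro n m hnm
  rw [((hc.zpow_zpow m n).eq).symm] at hnm
  exact (h m n hnm).symm

theorem MulIndep.of_map {G H : Type*} [Group G] [Group H] (f : G →* H) {u v : G}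
    (h : MulIndep (f u) (f v)) : MulIndep u v := by
  intro n m hnm
  apply h
  rw [← map_zpow, ← map_zpow, ← map_mul, hnm, map_one]

theorem MulIndep.map {G H : Type*} [Group G] [Group H] (f : G →* H)
    (hf : Function.Injective f) {u v : G}
    (h : MulIndep u v) : MulIndep (f u) (f v) := by
  intro n m hnm
  apply h
  apply hf
  rw [map_mul, map_zpow, map_zpow, hnm, map_one]

theorem isIntegral_one_add {A : Type*} [Ring A] {x : A} (hx : IsNilpotent x) :
    IsIntegral ℤ (1 + x) := by
  obtain ⟨k, hk⟩ := hx
  refine ⟨(Polynomial.X - Polynomial.C 1) ^ k, (Polynomial.monic_X_sub_C 1).pow k, ?_⟩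
  change Polynomial.aeval (1 + x) _ = 0
  simp [hk]

theorem IntUnit.map {A B : Type*} [Ring A] [Ring B] (f : A →+* B) {u : Aˣ} (h : IntUnit u) :
    IntUnit (Units.map (f : A →* B) u) := by
  refine ⟨?_, ?_⟩
  · exact h.1.map f.toIntAlgHom
  · exact h.2.map f.toIntAlgHom

theorem HasPair.of_injective {A B : Type*} [Ring A] [Ring B] (f : A →+* B)
    (hf : Function.Injective f) (h : HasPair A) : HasPair B := by
  obtain ⟨u, v, hc, hu, hv, hi⟩ := h
  refine ⟨Units.map (f : A →* B) u, Units.map (f : A →* B) v, hc.map _, hu.map f, hv.map f, ?_⟩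
  exact hi.map _ (Units.map_injective hf)

/-- inverse of a unipotent -/
theorem IntUnit.of_nilp {R : Type*} [CommRing R] {a b : R} (u : Rˣ)
    (ha : IsIntegral ℤ a) (hb : IsIntegral ℤ b)
    (h1 : IsNilpotent ((u : R) - a)) (h2 : IsNilpotent ((u : R) * b - 1)) : IntUnit u := by
  have key : ∀ x : R, IsNilpotent x → IsIntegral ℤ x := by
    intro x hx
    have := (isIntegral_one_add hx).sub isIntegral_one
    simpa using this
  refine ⟨?_, ?_⟩
  · have := (key _ h1).add ha
    simpa using this
  · have h3 : IsNilpotent (((u⁻¹ : Rˣ) : R) * ((u : R) * b - 1)) :=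
      Commute.isNilpotent_mul_left (Commute.all _ _) h2
    have := hb.sub (key _ h3)
    have e : b - ((u⁻¹ : Rˣ) : R) * ((u : R) * b - 1) = ((u⁻¹ : Rˣ) : R) := by
      rw [mul_sub, ← mul_assoc]; simp
    rwa [e] at this

theorem exists_ker_idem {R B : Type*} [CommRing R] [IsArtinianRing R] [CommRing B] (φ : R →+* B) :
    ∃ e : R, φ e = 0 ∧ e * e = e ∧ ∃ k : ℕ, 0 < k ∧ ∀ b, φ b = 0 → b ^ k * (1 - e) = 0 := by
  obtain ⟨n, hn⟩ := IsArtinian.monotone_stabilizes (R := R) (M := R)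
    ⟨fun n => OrderDual.toDual (RingHom.ker φ ^ n), fun a b hab => Ideal.pow_le_pow_right hab⟩
  have hn' : ∀ m, n ≤ m → RingHom.ker φ ^ n = RingHom.ker φ ^ m := fun m hm => hn m hm
  have hid : IsIdempotentElem (RingHom.ker φ ^ (n + 1)) := by
    unfold IsIdempotentElem
    rw [← pow_add, ← hn' (n + 1) (by omega), ← hn' _ (by omega)]
  obtain ⟨e, he, hs⟩ := (Ideal.isIdempotentElem_iff_of_fg _ (IsNoetherian.noetherian _)).1 hid
  refine ⟨e, ?_, he, n + 1, by omega, ?_⟩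
  · have : e ∈ RingHom.ker φ ^ (n + 1) := by rw [hs]; exact Ideal.mem_span_singleton_self e
    exact Ideal.pow_le_self (by omega) this
  · intro b hb
    have : b ^ (n + 1) ∈ RingHom.ker φ ^ (n + 1) := Ideal.pow_mem_pow hb _
    rw [hs] at this
    obtain ⟨c, hc⟩ := Ideal.mem_span_singleton'.1 this
    have he' : e * e = e := he
    rw [← hc]; linear_combination -c * he'

theorem isIntegral_lift {R B : Type*} [CommRing R] [CommRing B] (φ : R →+* B) {e : R}
    (he : e * e = e) {k : ℕ} (hk : ∀ b, φ b = 0 → b ^ k * (1 - e) = 0) {a : R}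
    (ha : IsIntegral ℤ (φ a)) : IsIntegral ℤ (a * (1 - e) + e) := by
  obtain ⟨F, hF, h0⟩ := ha
  refine ⟨F ^ k * (Polynomial.X - Polynomial.C 1), (hF.pow k).mul (Polynomial.monic_X_sub_C 1), ?_⟩
  change Polynomial.aeval _ _ = 0
  have h1 : φ (Polynomial.aeval a F) = 0 := by
    have := Polynomial.map_aeval_eq_aeval_map (R := ℤ) (S := R) (T := ℤ) (U := B) (φ := RingHom.id ℤ) (ψ := φ) (by ext; simp) F a
    rw [this, Polynomial.map_id]; exact h0
  have h2 := hk _ h1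
  obtain ⟨c, hc⟩ : a * (1 - e) + e - a ∣ Polynomial.aeval (a * (1 - e) + e) F - Polynomial.aeval a F := by
    rw [Polynomial.aeval_def, Polynomial.aeval_def, Polynomial.eval₂_eq_eval_map, Polynomial.eval₂_eq_eval_map]
    exact Polynomial.sub_dvd_eval_sub _ _ _
  have h3 : Polynomial.aeval (a * (1 - e) + e) F = Polynomial.aeval a F + e * (1 - a) * c := by
    rw [← sub_eq_iff_eq_add', hc]; ring
  obtain ⟨d, hd⟩ := sub_dvd_pow_sub_pow (Polynomial.aeval (a * (1 - e) + e) F) (Polynomial.aeval a F) k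
  rw [h3] at hd
  simp only [map_mul, map_pow, map_sub, Polynomial.aeval_X, map_one]
  rw [h3, sub_eq_iff_eq_add.1 hd]
  linear_combination (a - 1) * h2 - (1 - a) * c * d * (a-1) * he

theorem lift_unit_comm {R B : Type*} [CommRing R] [IsArtinianRing R] [CommRing B] (φ : R →+* B)
    {a a' : R} (u : Bˣ) (hu : IntUnit u) (ha : φ a = u) (ha' : φ a' = (u⁻¹ : Bˣ)) :
    ∃ U : Rˣ, φ U = u ∧ IntUnit U := by
  obtain ⟨e, he0, he, k, hk0, hk⟩ := exists_ker_idem φ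
  have h1 : IsIntegral ℤ (a * (1 - e) + e) := isIntegral_lift φ he hk (by rw [ha]; exact hu.1)
  have h2 : IsIntegral ℤ (a' * (1 - e) + e) := isIntegral_lift φ he hk (by rw [ha']; exact hu.2)
  have h3 : (a * (1 - e) + e) * (a' * (1 - e) + e) - 1 = (a * a' - 1) * (1 - e) := by
    linear_combination (1 - a - a' + a * a') * he
  have h4 : IsNilpotent ((a * (1 - e) + e) * (a' * (1 - e) + e) - 1) := by
    refine ⟨k, ?_⟩
    have h5 := hk (a * a' - 1) (by rw [map_sub, map_mul, ha, ha', map_one, Units.mul_inv, sub_self])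
    obtain ⟨j, rfl⟩ : ∃ j, k = j + 1 := ⟨k - 1, by omega⟩
    rw [h3, mul_pow, pow_succ (1 - e), mul_comm ((1 - e) ^ j), ← mul_assoc, h5, zero_mul]
  have h6 : IsUnit ((a * (1 - e) + e) * (a' * (1 - e) + e)) := by
    have := h4.isUnit_add_one
    simpa using this
  obtain ⟨U, hU⟩ := isUnit_of_mul_isUnit_left h6
  refine ⟨U, ?_, ?_⟩
  · rw [hU]; simp [he0, ha]
  · refine IntUnit.of_nilp U h1 h2 ?_ ?_
    · rw [hU, sub_self]; exact IsNilpotent.zero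
    · rw [hU]; exact h4

theorem lift_nilp_comm {R B : Type*} [CommRing R] [IsArtinianRing R] [CommRing B] (φ : R →+* B)
    {a : R} (ha : IsNilpotent (φ a)) : ∃ X : R, φ X = φ a ∧ IsNilpotent X := by
  obtain ⟨e, he0, he, k, hk0, hk⟩ := exists_ker_idem φ
  obtain ⟨j, hj⟩ := ha
  refine ⟨a * (1 - e), by simp [he0], (j + 1) * k, ?_⟩
  obtain ⟨i, rfl⟩ : ∃ i, k = i + 1 := ⟨k - 1, by omega⟩
  have := hk (a ^ (j + 1)) (by rw [map_pow, pow_succ, hj, zero_mul])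
  rw [mul_pow, pow_mul]
  have h9 : (1 - e) ^ ((j + 1) * (i + 1)) = (1 - e) * (1 - e) ^ ((j + 1) * (i + 1) - 1) := by
    rw [← pow_succ', Nat.sub_add_cancel (Nat.mul_pos (by omega) (by omega))]
  rw [h9, ← mul_assoc, this, zero_mul]

section noncomm
variable {A B : Type*} [Ring A] [Algebra ℚ A] [FiniteDimensional ℚ A] [CommRing B] [Algebra ℚ B]
  (π : A →ₐ[ℚ] B)

theorem lift_nilp {a : A} (ha : IsNilpotent (π a)) : ∃ X : A, π X = π a ∧ IsNilpotent X := by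
  letI : CommRing (Algebra.adjoin ℚ {a}) := Algebra.adjoinCommRingOfComm ℚ (by simp)
  haveI : IsArtinianRing (Algebra.adjoin ℚ {a}) := IsArtinianRing.of_finite ℚ _
  obtain ⟨X, hX, hn⟩ := lift_nilp_comm
    ((π.comp (Algebra.adjoin ℚ {a}).val : Algebra.adjoin ℚ {a} →ₐ[ℚ] B) :
      Algebra.adjoin ℚ {a} →+* B) (a := ⟨a, Algebra.self_mem_adjoin_singleton ℚ a⟩) ha
  exact ⟨X, hX, hn.map (Algebra.adjoin ℚ {a}).val⟩

theorem lift_unit {a : A} (u : Bˣ) (hu : IntUnit u) (ha : π a = u) :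
    ∃ U : Aˣ, (U : A) ∈ Algebra.adjoin ℚ {a} ∧ π U = u ∧ IntUnit U := by
  letI : CommRing (Algebra.adjoin ℚ {a}) := Algebra.adjoinCommRingOfComm ℚ (by simp)
  haveI : IsArtinianRing (Algebra.adjoin ℚ {a}) := IsArtinianRing.of_finite ℚ _
  set φ : Algebra.adjoin ℚ {a} →ₐ[ℚ] B := π.comp (Algebra.adjoin ℚ {a}).val with hφ
  set a0 : Algebra.adjoin ℚ {a} := ⟨a, Algebra.self_mem_adjoin_singleton ℚ a⟩ with ha0
  have h0 : φ a0 = u := ha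
  haveI : FiniteDimensional ℚ φ.range := Module.Finite.range φ.toLinearMap
  haveI : IsArtinianRing φ.range := IsArtinianRing.of_finite ℚ _
  have hun : IsUnit (φ.rangeRestrict a0) := by
    rw [IsArtinianRing.isUnit_iff_mem_nonZeroDivisors, mem_nonZeroDivisors_iff_right]
    intro x hx
    have : (x : B) * u = 0 := by
      have := congrArg Subtype.val hx
      rw [← h0]; exact this
    exact Subtype.ext (by simpa using this)
  obtain ⟨w, hw⟩ := hun.exists_right_inv
  obtain ⟨a', rfl⟩ := φ.rangeRestrict_surjective w
  have h1 : (u : B) * φ a' = 1 := by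
    rw [← h0]; exact congrArg Subtype.val hw
  have h2 : φ a' = (u⁻¹ : Bˣ) := by
    rw [← mul_one ((u⁻¹ : Bˣ) : B), ← h1, Units.inv_mul_cancel_left]
  obtain ⟨U, hU, hi⟩ := lift_unit_comm (φ : Algebra.adjoin ℚ {a} →+* B) u hu h0 h2
  refine ⟨Units.map (((Algebra.adjoin ℚ {a}).val : Algebra.adjoin ℚ {a} →+* A) : Algebra.adjoin ℚ {a} →* A) U, U.1.2, hU, ?_⟩
  exact hi.map ((Algebra.adjoin ℚ {a}).val : Algebra.adjoin ℚ {a} →+* A)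

theorem hasPair_of_commuting_lifts {a b : A} (hab : Commute a b) (u v : Bˣ) (hu : IntUnit u)
    (hv : IntUnit v) (hi : MulIndep u v) (ha : π a = u) (hb : π b = v) : HasPair A := by
  obtain ⟨U, hU, hUu, hU'⟩ := lift_unit π u hu ha
  obtain ⟨V, hV, hVv, hV'⟩ := lift_unit π v hv hb
  refine ⟨U, V, ?_, hU', hV', ?_⟩
  · have h1 : Commute a V := Algebra.commute_of_mem_adjoin_singleton_of_commute hV hab
    have h2 : Commute (V : A) U := Algebra.commute_of_mem_adjoin_singleton_of_commute hU h1.symm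
    exact Units.ext h2.symm.eq
  · apply MulIndep.of_map (Units.map (π : A →* B))
    have e1 : Units.map (π : A →* B) U = u := Units.ext hUu
    have e2 : Units.map (π : A →* B) V = v := Units.ext hVv
    rwa [e1, e2]

/-- killed by a squarefree polynomial -/
def SqFr {A : Type*} [Ring A] [Algebra ℚ A] (s : A) : Prop :=
  ∃ p : Polynomial ℚ, Squarefree p ∧ Polynomial.aeval s p = 0

theorem jordan (a : A) : ∃ s ∈ Algebra.adjoin ℚ {a}, SqFr s ∧ IsNilpotent (a - s) := by
  obtain ⟨n, hn, s, hs, hnil, hss, h⟩ :=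
    Module.End.exists_isNilpotent_isSemisimple (f := Algebra.lmul ℚ A a) (K := ℚ)
  have h1 : Algebra.adjoin ℚ {Algebra.lmul ℚ A a} = (Algebra.adjoin ℚ {a}).map (Algebra.lmul ℚ A) := by
    rw [AlgHom.map_adjoin, Set.image_singleton]
  rw [h1] at hs
  obtain ⟨S, hS, rfl⟩ := hs
  have hinj : Function.Injective (Algebra.lmul ℚ A) := Algebra.lmul_injective
  refine ⟨S, hS, ⟨_, hss.minpoly_squarefree, ?_⟩, ?_⟩
  · apply hinj
    rw [map_zero]
    have := minpoly.aeval ℚ (Algebra.lmul ℚ A S)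
    rw [← this]
    exact (Polynomial.aeval_algHom_apply _ _ _).symm
  · rw [← IsNilpotent.map_iff hinj, map_sub, h]
    simpa using hnil

theorem SqFr.lmul {A : Type*} [Ring A] [Algebra ℚ A] {s : A} (h : SqFr s) :
    (Algebra.lmul ℚ A s).IsSemisimple := by
  obtain ⟨p, hp, h⟩ := h
  refine Module.End.isSemisimple_of_squarefree_aeval_eq_zero hp ?_
  rw [Polynomial.aeval_algHom_apply, h, map_zero]

theorem SqFr.rmul {A : Type*} [Ring A] [Algebra ℚ A] {s : A} (h : SqFr s) :
    Module.End.IsSemisimple (LinearMap.mulRight ℚ s : Module.End ℚ A) := by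
  obtain ⟨p, hp, h⟩ := h
  refine Module.End.isSemisimple_of_squarefree_aeval_eq_zero hp ?_
  have : ∀ q : Polynomial ℚ, Polynomial.aeval (LinearMap.mulRight ℚ s : Module.End ℚ A) q
      = LinearMap.mulRight ℚ (Polynomial.aeval s q) := by
    intro q
    ext x
    induction q using Polynomial.induction_on' with
    | add p q hp hq => simp_all [mul_add]
    | monomial n c => simp [Polynomial.aeval_monomial, Algebra.algebraMap_eq_smul_one]
  rw [this, h]; ext; simp

theorem SqFr.unique [FiniteDimensional ℚ B] {s t : B} (hs : SqFr s) (ht : SqFr t)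
    (h : IsNilpotent (s - t)) : s = t := by
  have h1 : (Algebra.lmul ℚ B s - Algebra.lmul ℚ B t).IsSemisimple :=
    Module.End.IsSemisimple.sub_of_commute ((Commute.all s t).map _) hs.lmul ht.lmul
  rw [← map_sub] at h1
  have h2 := Module.End.eq_zero_of_isNilpotent_isSemisimple (h.map (Algebra.lmul ℚ B)) h1
  have hinj : Function.Injective (Algebra.lmul ℚ B) := Algebra.lmul_injective
  rw [← sub_eq_zero]
  exact hinj (by rw [h2, map_zero])

theorem SqFr.map {s : A} (h : SqFr s) : SqFr (π s) := by
  obtain ⟨p, hp, h⟩ := h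
  exact ⟨p, hp, by rw [Polynomial.aeval_algHom_apply, h, map_zero]⟩

theorem commuting_lifts [FiniteDimensional ℚ B] (hπ : Function.Surjective π) {s : B} (hs : SqFr s)
    (t : B) :
    ∃ S T : A, Commute S T ∧ π S = s ∧ π T = t := by
  obtain ⟨a, rfl⟩ := hπ s
  obtain ⟨t, rfl⟩ := hπ t
  obtain ⟨S, -, hS, hn⟩ := jordan a
  have hSa : π a = π S := SqFr.unique hs (hS.map π) (by rw [← map_sub]; exact hn.map π)
  set D : Module.End ℚ A := Algebra.lmul ℚ A S - LinearMap.mulRight ℚ S with hD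
  have hDs : D.IsSemisimple := by
    refine Module.End.IsSemisimple.sub_of_commute ?_ hS.lmul hS.rmul
    ext x; simp [mul_assoc]
  obtain ⟨q, hq, hc⟩ := Module.End.isSemisimple_iff.1 hDs (LinearMap.ker D) (by
    intro x hx
    simp only [Submodule.mem_comap, LinearMap.mem_ker] at hx ⊢
    rw [hx, map_zero])
  have ht : t ∈ LinearMap.ker D ⊔ q := by rw [hc.sup_eq_top]; trivial
  obtain ⟨T, hT, y, hy, rfl⟩ := Submodule.mem_sup.1 ht
  have hq' : ∀ x ∈ q, D x ∈ q := fun x hx => hq hx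
  have hinj : Function.Injective (D.restrict hq') := by
    rw [← LinearMap.ker_eq_bot, LinearMap.ker_eq_bot']
    intro m hm
    have h1 : D m = 0 := congrArg Subtype.val hm
    exact Subtype.ext ((Submodule.disjoint_def.1 hc.disjoint) m h1 m.2)
  obtain ⟨z, hz⟩ := LinearMap.surjective_of_injective hinj ⟨y, hy⟩
  have hz' : D z = y := congrArg Subtype.val hz
  refine ⟨S, T, ?_, hSa.symm, ?_⟩
  · have : S * T - T * S = 0 := by simpa [hD] using hT
    exact sub_eq_zero.1 this
  · rw [← hz', hD]
    simp [mul_comm]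
end noncomm

theorem eq_zero_of_exp_eq_one {A : Type*} [Ring A] [Algebra ℚ A] {z : A} (hz : IsNilpotent z)
    (h : IsNilpotent.exp z = 1) : z = 0 := by
  obtain ⟨k, hk⟩ := hz
  induction k with
  | zero =>
    rw [pow_zero] at hk
    rw [← mul_one z, hk, mul_zero]
  | succ k ih =>
    rcases k with _ | k
    · simpa using hk
    apply ih
    have h1 := IsNilpotent.exp_eq_sum hk
    rw [h, Finset.sum_range_succ', Finset.sum_range_succ'] at h1
    have h2 := congrArg (fun y => z ^ k * y) h1
    simp only [mul_add, Finset.mul_sum] at h2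
    rw [Finset.sum_eq_zero] at h2
    · simpa [← pow_succ] using h2
    · intro i _
      rw [mul_smul_comm, ← pow_add, pow_eq_zero_of_le (m := k + 1 + 1) (by omega) hk, smul_zero]

/-- one-parameter group of a nilpotent -/
noncomputable def expHom {A : Type*} [Ring A] [Algebra ℚ A] (x : A) (hx : IsNilpotent x) :
    Multiplicative ℤ →* Aˣ where
  toFun n := ⟨IsNilpotent.exp (n.toAdd • x), IsNilpotent.exp (-(n.toAdd • x)),
    IsNilpotent.exp_mul_exp_neg_self (hx.smul _), IsNilpotent.exp_neg_mul_exp_self (hx.smul _)⟩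
  map_one' := by
    ext; simp
  map_mul' n m := by
    ext
    simp only [toAdd_mul, add_smul, Units.val_mul]
    exact IsNilpotent.exp_add_of_commute (((Commute.refl x).smul_right _).smul_left _) (hx.smul _) (hx.smul _)

theorem expHom_zpow {A : Type*} [Ring A] [Algebra ℚ A] (x : A) (hx : IsNilpotent x) (n : ℤ) :
    (((expHom x hx (Multiplicative.ofAdd 1)) ^ n : Aˣ) : A) = IsNilpotent.exp (n • x) := by
  rw [← map_zpow, ← ofAdd_zsmul]
  simp [expHom]

theorem expHom_intUnit {A : Type*} [Ring A] [Algebra ℚ A] (x : A) (hx : IsNilpotent x) :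
    IntUnit (expHom x hx (Multiplicative.ofAdd 1)) := by
  have key : ∀ y : A, IsNilpotent y → IsIntegral ℤ (IsNilpotent.exp y) := fun y hy => by
    have := isIntegral_one_add (IsNilpotent.isNilpotent_exp_sub_one hy)
    simpa using this
  exact ⟨key _ (hx.smul _), key _ (hx.smul _).neg⟩

theorem hasPair_of_nilp {A : Type*} [Ring A] [Algebra ℚ A] {x y : A} (hx : IsNilpotent x)
    (hy : IsNilpotent y) (hc : Commute x y)
    (h : ∀ n m : ℤ, n • x + m • y = 0 → n = 0 ∧ m = 0) : HasPair A := by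
  have hcc : ∀ n m : ℤ, Commute (n • x) (m • y) := fun n m => (hc.smul_right _).smul_left _
  have key : ∀ n m : ℤ, IsNilpotent.exp (n • x) * IsNilpotent.exp (m • y) =
      IsNilpotent.exp (n • x + m • y) := fun n m =>
    (IsNilpotent.exp_add_of_commute (hcc n m) (hx.smul _) (hy.smul _)).symm
  refine ⟨_, _, ?_, expHom_intUnit x hx, expHom_intUnit y hy, ?_⟩
  · ext
    have e1 := expHom_zpow x hx 1
    have e2 := expHom_zpow y hy 1
    rw [zpow_one] at e1 e2
    rw [Units.val_mul, Units.val_mul, e1, e2, key, add_comm]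
    exact IsNilpotent.exp_add_of_commute (hcc 1 1).symm (hy.smul _) (hx.smul _)
  · intro n m hnm
    have := congrArg Units.val hnm
    rw [Units.val_mul, expHom_zpow, expHom_zpow, key, Units.val_one] at this
    exact h n m (eq_zero_of_exp_eq_one ((hcc n m).isNilpotent_add (hx.smul _) (hy.smul _)) this)

theorem zpow_one_add_sqz {B : Type*} [CommRing B] {x : B} (hx : x * x = 0) (u : Bˣ)
    (hu : (u : B) = 1 + x) (n : ℤ) : ((u ^ n : Bˣ) : B) = 1 + n * x := by
  have hinv : ((u⁻¹ : Bˣ) : B) = 1 - x := by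
    rw [Units.inv_eq_of_mul_eq_one_right (a := 1 - x)]
    rw [hu]; linear_combination -hx
  induction n using Int.induction_on with
  | zero => simp
  | succ n ih => rw [zpow_add_one, Units.val_mul, ih, hu]; push_cast; linear_combination n * hx
  | pred n ih => rw [zpow_sub_one, Units.val_mul, ih, hinv]; push_cast; linear_combination n * hx

section core
variable {A B : Type*} [Ring A] [Algebra ℚ A] [FiniteDimensional ℚ A] [CommRing B] [Algebra ℚ B]
  [FiniteDimensional ℚ B] (π : A →ₐ[ℚ] B)

theorem unipotent_case (hπ : Function.Surjective π) (u v : Bˣ) (hi : MulIndep u v)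
    (hu : IsNilpotent ((u : B) - 1)) (hv : IsNilpotent ((v : B) - 1)) : HasPair A := by
  by_contra hA
  have dep : ∀ X Y : A, IsNilpotent X → IsNilpotent Y → Commute X Y →
      ∃ n m : ℤ, n • X + m • Y = 0 ∧ ¬ (n = 0 ∧ m = 0) := by
    intro X Y hX hY hc
    by_contra! h
    exact hA (hasPair_of_nilp hX hY hc h)
  have tf : ∀ (n : ℤ) (X : A), n • X = 0 → n = 0 ∨ X = 0 := by
    intro n X h
    rw [← Int.cast_smul_eq_zsmul ℚ] at h
    simpa using h
  have tfB : ∀ (n : ℤ) (X : B), n • X = 0 → n = 0 ∨ X = 0 := by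
    intro n X h
    rw [← Int.cast_smul_eq_zsmul ℚ] at h
    simpa using h
  have sq : ∀ X : A, IsNilpotent X → X * X = 0 := by
    intro X hX
    obtain ⟨n, m, h, hnm⟩ := dep X (X * X) hX
      (Commute.isNilpotent_mul_left (Commute.refl X) hX) ((Commute.refl X).mul_right (Commute.refl X))
    by_cases hn : n = 0
    · subst hn
      rw [zero_smul, zero_add] at h
      exact (tf m _ h).resolve_left (by tauto)
    · have h1 : ∀ k, X ^ (k + 1) = 0 → X = 0 := by
        intro k
        induction k with
        | zero => intro h; simpa using h
        | succ k ih =>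
          intro hk
          apply ih
          have h2 := congrArg (fun y => X ^ k * y) h
          simp only [mul_add, mul_smul_comm, mul_zero] at h2
          rw [← pow_succ, ← mul_assoc, ← pow_succ, ← pow_succ, hk, smul_zero, add_zero] at h2
          exact (tf n _ h2).resolve_left hn
      obtain ⟨k, hk⟩ := hX
      rw [h1 k (by rw [pow_succ, hk, zero_mul]), zero_mul]
  have lift : ∀ x : B, IsNilpotent x → ∃ X : A, π X = x ∧ IsNilpotent X := by
    intro x hx
    obtain ⟨a, rfl⟩ := hπ x
    exact lift_nilp π hx
  have sqB : ∀ x : B, IsNilpotent x → x * x = 0 := by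
    intro x hx
    obtain ⟨X, rfl, hX⟩ := lift x hx
    rw [← map_mul, sq X hX, map_zero]
  obtain ⟨x, hx⟩ : ∃ x : B, x = (u : B) - 1 := ⟨_, rfl⟩
  obtain ⟨y, hy⟩ : ∃ y : B, y = (v : B) - 1 := ⟨_, rfl⟩
  rw [← hx] at hu
  rw [← hy] at hv
  have hx2 := sqB x hu
  have hy2 := sqB y hv
  have hxy : x * y = 0 := by
    have h1 := sqB (x + y) ((Commute.all x y).isNilpotent_add hu hv)
    have h2 : (2 : ℤ) • (x * y) = 0 := by
      rw [zsmul_eq_mul]; push_cast; linear_combination h1 - hx2 - hy2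
    exact (tfB _ _ h2).resolve_left (by norm_num)
  have ind : ∀ n m : ℤ, n • x + m • y = 0 → n = 0 ∧ m = 0 := by
    intro n m h
    apply hi
    ext
    rw [Units.val_mul, zpow_one_add_sqz hx2 u (by rw [hx]; ring), zpow_one_add_sqz hy2 v (by rw [hy]; ring)]
    rw [zsmul_eq_mul, zsmul_eq_mul] at h
    push_cast
    linear_combination h + n * m * hxy
  have hx0 : ∀ n : ℤ, n • x = 0 → n = 0 := fun n h => (ind n 0 (by simpa using h)).1
  have hy0 : ∀ n : ℤ, n • y = 0 → n = 0 := fun n h => (ind 0 n (by simpa using h)).2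
  -- an element commuting with a lift, and killed by the projection, vanishes
  have kill : ∀ X Z : A, IsNilpotent X → IsNilpotent Z → Commute X Z → π Z = 0 →
      (∀ n : ℤ, n • π X = 0 → n = 0) → Z = 0 := by
    intro X Z hX hZ hc hZ0 hX0
    obtain ⟨n, m, h, hnm⟩ := dep X Z hX hZ hc
    have h1 := congrArg π h
    rw [map_add, map_zsmul, map_zsmul, hZ0, smul_zero, add_zero, map_zero] at h1
    have hn := hX0 n h1
    subst hn
    rw [zero_smul, zero_add] at h
    exact (tf m _ h).resolve_left (by tauto)
  have prod : ∀ X Y : A, IsNilpotent X → IsNilpotent Y → π X * π Y = 0 →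
      (∀ n : ℤ, n • π X = 0 → n = 0) → X * Y = 0 := by
    intro X Y hX hY h hX0
    have hXX := sq X hX
    have h1 : X * Y * X = 0 := by
      refine kill X _ hX ⟨2, ?_⟩ ?_ ?_ hX0
      · rw [pow_two, show X * Y * X * (X * Y * X) = X * Y * (X * X) * Y * X by noncomm_ring, hXX]
        simp
      · change X * (X * Y * X) = X * Y * X * X
        rw [mul_assoc (X * Y), hXX, ← mul_assoc, ← mul_assoc, hXX]; simp
      · rw [map_mul, map_mul, h, zero_mul]
    refine kill X _ hX ⟨2, ?_⟩ ?_ ?_ hX0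
    · rw [pow_two, ← mul_assoc, h1, zero_mul]
    · change X * (X * Y) = X * Y * X
      rw [h1, ← mul_assoc, hXX, zero_mul]
    · rw [map_mul, h]
  obtain ⟨X, rfl, hX⟩ := lift x hu
  obtain ⟨Y, rfl, hY⟩ := lift y hv
  have h1 := prod X Y hX hY hxy hx0
  have h2 := prod Y X hY hX (by rw [mul_comm]; exact hxy) hy0
  obtain ⟨n, m, h, hnm⟩ := dep X Y hX hY (by rw [Commute, SemiconjBy, h1, h2])
  apply hnm
  apply ind
  rw [← map_zsmul, ← map_zsmul, ← map_add, h, map_zero]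

theorem step_case (hπ : Function.Surjective π) (u v : Bˣ) (hu : IntUnit u) (hv : IntUnit v)
    (hi : MulIndep u v) : HasPair A ∨ ∃ n : ℤ, n ≠ 0 ∧ IsNilpotent (((u ^ n : Bˣ) : B) - 1) := by
  obtain ⟨s, hs, hsq, hnil⟩ := jordan (u : B)
  have hsu : IsUnit s := by
    have := hnil.neg.isUnit_add_right_of_commute u.isUnit (Commute.all _ _)
    simpa using this
  obtain ⟨s, rfl⟩ := hsu
  have hnil' : IsNilpotent ((s : B) - u) := by simpa using hnil.neg
  have hsi : IntUnit s := by
    refine IntUnit.of_nilp s hu.1 hu.2 hnil' ?_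
    have := Commute.isNilpotent_mul_left (Commute.all (((u⁻¹ : Bˣ)) : B) _) hnil'
    convert this using 1
    rw [mul_sub, Units.inv_mul, mul_comm]
  by_cases hsv : MulIndep s v
  · left
    obtain ⟨S, T, hc, hS, hT⟩ := commuting_lifts π hπ hsq v
    exact hasPair_of_commuting_lifts π hc s v hsi hv hsv hS hT
  unfold MulIndep at hsv
  push Not at hsv
  obtain ⟨n, m, hnm, h0⟩ := hsv
  by_cases hm : m = 0
  · right
    refine ⟨n, fun hn => h0 hn hm, ?_⟩
    subst hm
    have hsn : s ^ n = 1 := by simpa using hnm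
    have hN : IsNilpotent (((u * s⁻¹ : Bˣ) : B) - 1) := by
      have := Commute.isNilpotent_mul_left (Commute.all (((s⁻¹ : Bˣ)) : B) _) hnil
      convert this using 1
      rw [mul_sub, Units.inv_mul, mul_comm, Units.val_mul]
    have hun : u ^ n = (u * s⁻¹) ^ n := by rw [mul_zpow, inv_zpow, hsn, inv_one, mul_one]
    rw [hun]
    have gen : ∀ (w : Bˣ) (k : ℕ), IsNilpotent ((w : B) - 1) → IsNilpotent (((w ^ k : Bˣ) : B) - 1) := by
      intro w k hw
      obtain ⟨c, hc⟩ := sub_one_dvd_pow_sub_one (w : B) k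
      rw [Units.val_pow_eq_pow_val, hc]
      exact Commute.isNilpotent_mul_right (Commute.all _ _) hw
    rcases Int.eq_nat_or_neg n with ⟨k, rfl | rfl⟩
    · rw [zpow_natCast]; exact gen _ _ hN
    · rw [zpow_neg, ← inv_zpow, zpow_natCast]
      apply gen
      have := Commute.isNilpotent_mul_left (Commute.all ((((u * s⁻¹)⁻¹ : Bˣ)) : B) _) hN.neg
      convert this using 1
      rw [mul_neg, mul_sub, Units.inv_mul]; ring
  · left
    have hn : n ≠ 0 := by
      rintro rfl
      exact hm (hi 0 m (by simpa using hnm)).2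
    obtain ⟨a, ha⟩ := hπ u
    have hs' : (s : B) ∈ (Algebra.adjoin ℚ {a}).map π := by
      rw [AlgHom.map_adjoin, Set.image_singleton, ha]; exact hs
    obtain ⟨S, hS, hSs⟩ := hs'
    refine hasPair_of_commuting_lifts π (Algebra.commute_of_mem_adjoin_self hS) u s hu hsi ?_ ha hSs
    intro i j hij
    have h1 : u ^ (i * n) * v ^ (-(m * j)) = 1 := by
      have h2 : s ^ n = v ^ (-m) := by rw [zpow_neg]; exact eq_inv_of_mul_eq_one_left hnm
      have h3 : (u ^ i * s ^ j) ^ n = 1 := by rw [hij, one_zpow]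
      rw [mul_zpow, ← zpow_mul, ← zpow_mul, mul_comm j n, zpow_mul s, h2, ← zpow_mul] at h3
      rw [← h3, neg_mul]
    obtain ⟨h2, h3⟩ := hi _ _ h1
    simp [hn, hm] at h2 h3
    exact ⟨h2, h3⟩

theorem core_comm (hπ : Function.Surjective π) (h : HasPair B) : HasPair A := by
  obtain ⟨u, v, hc, hu, hv, hi⟩ := h
  rcases step_case π hπ u v hu hv hi with h | ⟨n, hn, h1⟩
  · exact h
  rcases step_case π hπ v u hv hu (hi.symm hc) with h | ⟨m, hm, h2⟩
  · exact h
  refine unipotent_case π hπ (u ^ n) (v ^ m) ?_ h1 h2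
  intro i j hij
  rw [← zpow_mul, ← zpow_mul] at hij
  obtain ⟨h2, h3⟩ := hi _ _ hij
  simp [hn, hm] at h2 h3
  exact ⟨h2, h3⟩

end core

theorem hasPair_quot {A B : Type*} [Ring A] [Algebra ℚ A] [FiniteDimensional ℚ A] [Ring B]
    [Algebra ℚ B] (π : A →ₐ[ℚ] B) (hπ : Function.Surjective π) (h : HasPair B) : HasPair A := by
  obtain ⟨u, v, hc, hu, hv, hi⟩ := h
  haveI : FiniteDimensional ℚ B := Module.Finite.of_surjective π.toLinearMap hπ
  set s : Set B := {(u : B), ((u⁻¹ : Bˣ) : B), (v : B), ((v⁻¹ : Bˣ) : B)} with hs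
  have hcs : ∀ a ∈ s, ∀ b ∈ s, a * b = b * a := by
    have h2 : ∀ a b : Bˣ, Commute a b → (a : B) * b = b * a := fun a b hab => by
      rw [← Units.val_mul, hab.eq, Units.val_mul]
    have := h2 _ _ hc
    have := h2 _ _ hc.inv_left
    have := h2 _ _ hc.inv_right
    have := h2 _ _ hc.inv_inv
    rintro a (rfl | rfl | rfl | rfl) b (rfl | rfl | rfl | rfl) <;> simp_all
  let C := Algebra.adjoin ℚ s
  letI : CommRing C := Algebra.adjoinCommRingOfComm ℚ hcs
  have hm : ∀ x ∈ s, x ∈ C := fun x hx => Algebra.subset_adjoin hx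
  let u' : Cˣ := ⟨⟨u, hm _ (by simp [hs])⟩, ⟨((u⁻¹ : Bˣ) : B), hm _ (by simp [hs])⟩,
    Subtype.ext u.mul_inv, Subtype.ext u.inv_mul⟩
  let v' : Cˣ := ⟨⟨v, hm _ (by simp [hs])⟩, ⟨((v⁻¹ : Bˣ) : B), hm _ (by simp [hs])⟩,
    Subtype.ext v.mul_inv, Subtype.ext v.inv_mul⟩
  have hIntg : ∀ x : C, IsIntegral ℤ (x : B) → IsIntegral ℤ x := by
    intro x hx
    exact (isIntegral_algHom_iff ((C.val : C →+* B).toIntAlgHom) Subtype.val_injective).1 hx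
  have hC : HasPair C := by
    refine ⟨u', v', Commute.all _ _, ⟨hIntg _ hu.1, hIntg _ hu.2⟩, ⟨hIntg _ hv.1, hIntg _ hv.2⟩, ?_⟩
    apply MulIndep.of_map (Units.map ((C.val : C →+* B) : C →* B))
    have e1 : Units.map ((C.val : C →+* B) : C →* B) u' = u := Units.ext rfl
    have e2 : Units.map ((C.val : C →+* B) : C →* B) v' = v := Units.ext rfl
    rw [e1, e2]
    exact hi
  let A' := C.comap π
  let π' : A' →ₐ[ℚ] C := (π.comp A'.val).codRestrict C (fun x => x.2)
  have hπ' : Function.Surjective π' := by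
    rintro ⟨c, hc⟩
    obtain ⟨a, rfl⟩ := hπ c
    exact ⟨⟨a, hc⟩, rfl⟩
  have := core_comm π' hπ' hC
  exact this.of_injective (A'.val : A' →+* A) Subtype.val_injective

theorem hasPair_of_order {B : Type*} [Ring B] [Algebra ℚ B] (Γ : Subring B) (hΓ : IsZOrder B Γ)
    (h : HasZxZ Γˣ) : HasPair B := by
  obtain ⟨f, hf⟩ := h
  have hfin : Module.Finite ℤ Γ := by
    have := hΓ.1
    rw [← AddGroup.fg_iff_addSubgroup_fg, ← Module.Finite.iff_addGroup_fg] at this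
    exact this
  have hIntg : ∀ u : Γˣ, IntUnit u := fun u => ⟨IsIntegral.of_finite ℤ _, IsIntegral.of_finite ℤ _⟩
  have : HasPair Γ := by
    refine ⟨f (Multiplicative.ofAdd (1, 0)), f (Multiplicative.ofAdd (0, 1)),
      (Commute.all _ _).map f, hIntg _, hIntg _, ?_⟩
    apply MulIndep.map f hf
    intro n m h
    rw [← ofAdd_zsmul, ← ofAdd_zsmul, ← ofAdd_add, ofAdd_eq_one] at h
    simpa using h
  exact this.of_injective Γ.subtype Subtype.val_injective

theorem exists_zsmul_mem {A : Type*} [Ring A] [Algebra ℚ A] (L : Submodule ℤ A)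
    (hL : Submodule.span ℚ (L : Set A) = ⊤) (a : A) : ∃ n : ℤ, n ≠ 0 ∧ n • a ∈ L := by
  have ha : a ∈ Submodule.span ℚ (L : Set A) := by rw [hL]; trivial
  induction ha using Submodule.span_induction with
  | mem x hx => exact ⟨1, one_ne_zero, by simpa using hx⟩
  | zero => exact ⟨1, one_ne_zero, by simp⟩
  | add x y _ _ hx hy =>
    obtain ⟨n, hn, hx⟩ := hx
    obtain ⟨m, hm, hy⟩ := hy
    refine ⟨n * m, mul_ne_zero hn hm, ?_⟩
    rw [smul_add]
    refine L.add_mem ?_ ?_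
    · rw [mul_comm, mul_smul]; exact L.smul_mem _ hx
    · rw [mul_smul]; exact L.smul_mem _ hy
  | smul q x _ hx =>
    obtain ⟨n, hn, hx⟩ := hx
    refine ⟨n * q.den, mul_ne_zero hn (by exact_mod_cast q.den_ne_zero), ?_⟩
    have : (n * (q.den : ℤ)) • q • x = q.num • n • x := by
      rw [← Int.cast_smul_eq_zsmul ℚ, ← Int.cast_smul_eq_zsmul ℚ, ← Int.cast_smul_eq_zsmul ℚ,
        smul_smul, smul_smul]
      congr 1
      push_cast
      rw [mul_assoc, mul_comm (q.den : ℚ), Rat.mul_den_eq_num, mul_comm]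
    rw [this]
    exact L.smul_mem _ hx

/-- left order of a lattice -/
def leftOrder {A : Type*} [Ring A] (L : Submodule ℤ A) : Subring A where
  carrier := {a | ∀ l ∈ L, a * l ∈ L}
  mul_mem' := fun {a b} ha hb l hl => by rw [mul_assoc]; exact ha _ (hb l hl)
  one_mem' := fun l hl => by simpa using hl
  add_mem' := fun {a b} ha hb l hl => by rw [add_mul]; exact L.add_mem (ha l hl) (hb l hl)
  zero_mem' := fun l hl => by simp
  neg_mem' := fun {a} ha l hl => by rw [neg_mul]; exact L.neg_mem (ha l hl)

theorem leftOrder_isZOrder {A : Type*} [Ring A] [Algebra ℚ A] (L : Submodule ℤ A) (hfg : L.FG)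
    (hL : Submodule.span ℚ (L : Set A) = ⊤) : IsZOrder A (leftOrder L) := by
  have tf : ∀ (n : ℤ) (X : A), n ≠ 0 → n • X = 0 → X = 0 := by
    intro n X hn h
    rw [← Int.cast_smul_eq_zsmul ℚ] at h
    simpa [hn] using h
  refine ⟨?_, ?_⟩
  · rw [← AddGroup.fg_iff_addSubgroup_fg, ← Module.Finite.iff_addGroup_fg]
    obtain ⟨n, hn, h1⟩ := exists_zsmul_mem L hL 1
    haveI : Module.Finite ℤ L := Module.Finite.iff_fg.2 hfg
    let f : (leftOrder L).toAddSubgroup →+ L :=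
      { toFun := fun a => ⟨n • (a : A), by
          have := a.2 _ h1
          rwa [mul_smul_comm, mul_one] at this⟩
        map_zero' := by simp
        map_add' := fun a b => by ext; simp }
    refine Module.Finite.of_injective f.toIntLinearMap ?_
    rw [← LinearMap.ker_eq_bot, LinearMap.ker_eq_bot']
    intro a ha
    exact Subtype.ext (tf n _ hn (congrArg Subtype.val ha))
  · rw [eq_top_iff]
    intro a _
    obtain ⟨S, hS⟩ := hfg
    have key : ∀ T : Finset A, ∃ n : ℤ, n ≠ 0 ∧ ∀ t ∈ T, n • (a * t) ∈ L := by
      intro T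
      classical
      induction T using Finset.induction_on with
      | empty => exact ⟨1, one_ne_zero, by simp⟩
      | insert t T _ ih =>
        obtain ⟨n, hn, h⟩ := ih
        obtain ⟨m, hm, h'⟩ := exists_zsmul_mem L hL (a * t)
        refine ⟨n * m, mul_ne_zero hn hm, fun x hx => ?_⟩
        rcases Finset.mem_insert.1 hx with rfl | hx
        · rw [mul_smul]; exact L.smul_mem _ h'
        · rw [mul_comm, mul_smul]; exact L.smul_mem _ (h x hx)
    obtain ⟨n, hn, h⟩ := key S
    have hna : n • a ∈ leftOrder L := by
      intro l hl
      rw [← hS] at hl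
      induction hl using Submodule.span_induction with
      | mem x hx => rw [smul_mul_assoc]; exact h x hx
      | zero => simp
      | add x y _ _ hx hy => rw [mul_add]; exact L.add_mem hx hy
      | smul c x _ hx => rw [mul_smul_comm]; exact L.smul_mem _ hx
    have : a = (n : ℚ)⁻¹ • (n • a) := by
      rw [← Int.cast_smul_eq_zsmul ℚ, smul_smul, inv_mul_cancel₀ (by exact_mod_cast hn), one_smul]
    rw [this]
    exact Submodule.smul_mem _ _ (Submodule.subset_span hna)

theorem not_hyperbolic_of_hasPair {A : Type*} [Ring A] [Algebra ℚ A] [FiniteDimensional ℚ A]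
    (h : HasPair A) : ¬ HasHyperbolicProperty A := by
  obtain ⟨u, v, hc, hu, hv, hi⟩ := h
  set s : Set A := {(u : A), ((u⁻¹ : Aˣ) : A), (v : A), ((v⁻¹ : Aˣ) : A)} with hs
  have hcs : ∀ a ∈ s, ∀ b ∈ s, a * b = b * a := by
    have h2 : ∀ a b : Aˣ, Commute a b → (a : A) * b = b * a := fun a b hab => by
      rw [← Units.val_mul, hab.eq, Units.val_mul]
    have := h2 _ _ hc
    have := h2 _ _ hc.inv_left
    have := h2 _ _ hc.inv_right
    have := h2 _ _ hc.inv_inv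
    rintro a (rfl | rfl | rfl | rfl) b (rfl | rfl | rfl | rfl) <;> simp_all
  have hIntS : ∀ a ∈ s, IsIntegral ℤ a := by
    rintro a (rfl | rfl | rfl | rfl)
    exacts [hu.1, hu.2, hv.1, hv.2]
  let C := Algebra.adjoin ℤ s
  letI : CommRing C := Algebra.adjoinCommRingOfComm ℤ hcs
  have hm : ∀ x ∈ s, x ∈ C := fun x hx => Algebra.subset_adjoin hx
  have hCfg : (Subalgebra.toSubmodule C).FG := by
    have hIntg : ∀ x : C, IsIntegral ℤ (x : A) → IsIntegral ℤ x := fun x hx =>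
      (isIntegral_algHom_iff C.val Subtype.val_injective).1 hx
    have h1 := fg_adjoin_of_finite (R := ℤ) (A := C) (s := (C.val ⁻¹' s))
      (Set.Finite.preimage Subtype.val_injective.injOn (by simp [hs]))
      (fun x hx => hIntg x (hIntS _ hx))
    have h2 : (Algebra.adjoin ℤ (C.val ⁻¹' s)).map C.val = C := by
      rw [AlgHom.map_adjoin, Set.image_preimage_eq_of_subset]
      intro x hx
      exact ⟨⟨x, hm x hx⟩, rfl⟩
    have h3 := h1.map C.val.toLinearMap
    rw [← Subalgebra.map_toSubmodule] at h3
    rwa [h2] at h3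
  let b := Module.finBasis ℚ A
  let L : Submodule ℤ A := Subalgebra.toSubmodule C * Submodule.span ℤ (Set.range b)
  have hLfg : L.FG := hCfg.mul (Submodule.fg_span (Set.finite_range b))
  have hLs : Submodule.span ℚ (L : Set A) = ⊤ := by
    rw [eq_top_iff, ← b.span_eq]
    refine Submodule.span_mono ?_
    intro x hx
    have : 1 * x ∈ L := Submodule.mul_mem_mul C.one_mem (Submodule.subset_span hx)
    simpa using this
  have hCL : ∀ c ∈ C, c ∈ leftOrder L := by
    intro c hc l hl
    have h1 : c * l ∈ Subalgebra.toSubmodule C * L := Submodule.mul_mem_mul hc hl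
    rwa [← mul_assoc, (Subalgebra.isIdempotentElem_toSubmodule C).eq] at h1
  intro hA
  refine hA (leftOrder L) (leftOrder_isZOrder L hLfg hLs) ?_
  let Γ := leftOrder L
  let u' : Γˣ := ⟨⟨u, hCL _ (hm _ (by simp [hs]))⟩, ⟨((u⁻¹ : Aˣ) : A), hCL _ (hm _ (by simp [hs]))⟩,
    Subtype.ext u.mul_inv, Subtype.ext u.inv_mul⟩
  let v' : Γˣ := ⟨⟨v, hCL _ (hm _ (by simp [hs]))⟩, ⟨((v⁻¹ : Aˣ) : A), hCL _ (hm _ (by simp [hs]))⟩,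
    Subtype.ext v.mul_inv, Subtype.ext v.inv_mul⟩
  have hc' : Commute u' v' := Units.ext (Subtype.ext (congrArg Units.val hc.eq))
  have hi' : MulIndep u' v' := by
    apply MulIndep.of_map (Units.map (Γ.subtype : Γ →* A))
    have e1 : Units.map (Γ.subtype : Γ →* A) u' = u := Units.ext rfl
    have e2 : Units.map (Γ.subtype : Γ →* A) v' = v := Units.ext rfl
    rw [e1, e2]
    exact hi
  let f : Multiplicative (ℤ × ℤ) →* Γˣ :=
    { toFun := fun z => u' ^ z.toAdd.1 * v' ^ z.toAdd.2
      map_one' := by simp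
      map_mul' := fun x y => by
        simp only [toAdd_mul, Prod.fst_add, Prod.snd_add, zpow_add]
        rw [mul_assoc, mul_assoc, ← mul_assoc (u' ^ y.toAdd.1), ← mul_assoc (v' ^ x.toAdd.2),
          (hc'.zpow_zpow y.toAdd.1 x.toAdd.2).eq] }
  refine ⟨f, (injective_iff_map_eq_one f).2 ?_⟩
  intro z hz
  obtain ⟨h1, h2⟩ := hi' _ _ hz
  exact Multiplicative.toAdd.injective (Prod.ext h1 h2)

theorem hyperbolic_of_quotient (A : Type*) [Ring A] [Algebra ℚ A]
    [FiniteDimensional ℚ A] (hA : HasHyperbolicProperty A)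
    (I : TwoSidedIdeal A) (hI : I ≠ ⊤) :
    HasHyperbolicProperty I.ringCon.Quotient := by
  intro Γ hΓ h
  let π : A →ₐ[ℚ] I.ringCon.Quotient :=
    { (I.ringCon.mk' : A →+* I.ringCon.Quotient) with commutes' := fun _ => rfl }
  have hπ : Function.Surjective π := fun x => Quotient.inductionOn' x fun a => ⟨a, rfl⟩
  exact not_hyperbolic_of_hasPair (hasPair_quot π hπ (hasPair_of_order Γ hΓ h)) hA
end

section
/- Let A be a finite-dimensional ℚ-algebra with the hyperbolic property and with nonzero Jacobson radical J(A). Then every ℤ-order in the semisimple quotient A/J(A) has finite unit group. -/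
theorem aux_pow {R : Type*} [Ring R] (y : R) (k : ℕ) (hk : 1 ≤ k) (n : ℕ) :
    ∃ w : R, (1 + (3:ℤ)^k • y)^n = 1 + ((n:ℤ) * 3^k) • y + (3:ℤ)^(k+1) • w := by
  induction n with
  | zero => exact ⟨0, by simp⟩
  | succ n ih =>
    obtain ⟨w, hw⟩ := ih
    obtain ⟨j, rfl⟩ : ∃ j, k = j + 1 := ⟨k-1, by omega⟩
    refine ⟨((n:ℤ) * 3^j) • (y*y) + w + (3:ℤ)^(j+1) • (w*y), ?_⟩
    rw [pow_succ, hw]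
    simp only [mul_add, add_mul, one_mul, mul_one, smul_mul_assoc, mul_smul_comm, smul_add, smul_smul]
    push_cast
    module

theorem aux_three {R : Type*} [Ring R] (y : R) (k : ℕ) (hk : 1 ≤ k) :
    ∃ w : R, (1 + (3:ℤ)^k • y)^3 = 1 + (3:ℤ)^(k+1) • (y + (3:ℤ) • w) := by
  obtain ⟨j, rfl⟩ : ∃ j, k = j + 1 := ⟨k-1, by omega⟩
  refine ⟨(3:ℤ)^j • (y*y) + (3:ℤ)^(2*j) • (y*y*y), ?_⟩
  simp only [pow_succ (M := R), pow_zero, mul_add, add_mul, one_mul, mul_one, smul_mul_assoc, mul_smul_comm, smul_add, smul_smul]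
  module

theorem aux_tf {R : Type*} [Ring R] [Module.IsTorsionFree ℤ R] (n : ℕ) :
    n ≠ 0 → ∀ (y : R) (k : ℕ), 1 ≤ k → (¬ ∃ x, y = (3:ℤ) • x) →
      (1 + (3:ℤ)^k • y)^n ≠ 1 := by
  induction n using Nat.strong_induction_on with
  | _ n ih =>
    intro hn y k hk hy h1
    by_cases h3 : 3 ∣ n
    · obtain ⟨m, rfl⟩ := h3
      obtain ⟨w, hw⟩ := aux_three y k hk
      rw [pow_mul, hw] at h1
      refine ih m (by omega) (by omega) _ (k+1) (by omega) ?_ h1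
      rintro ⟨x, hx⟩
      exact hy ⟨x - w, by rw [smul_sub, ← hx]; abel⟩
    · obtain ⟨w, hw⟩ := aux_pow y k hk n
      rw [hw] at h1
      have h2 : (3:ℤ)^k • ((n:ℤ) • y + (3:ℤ) • w) = 0 := by
        have : (((n:ℤ) * 3^k) • y + (3:ℤ)^(k+1) • w) = 0 := by
          rw [add_assoc] at h1; simpa using h1
        rw [← this]; module
      have h4 : (n:ℤ) • y + (3:ℤ) • w = 0 := by
        rcases smul_eq_zero.1 h2 with h | h
        · exact absurd h (by positivity)
        · exact h
      have hc : IsCoprime (n:ℤ) 3 := by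
        have h5 : Nat.Coprime n 3 := ((Nat.Prime.coprime_iff_not_dvd Nat.prime_three).2 h3).symm
        exact_mod_cast Nat.isCoprime_iff_coprime.2 h5
      obtain ⟨a, b, hab⟩ := hc
      refine hy ⟨b • y - a • w, ?_⟩
      calc y = (a * n + b * 3) • y - a • ((n:ℤ) • y + (3:ℤ) • w) := by
              rw [h4, hab]; simp
        _ = _ := by module

theorem aux_div {R : Type*} [AddCommGroup R] [Module.IsTorsionFree ℤ R] [Module.Finite ℤ R]
    (x : R) (hx : x ≠ 0) : ∃ k : ℕ, ∃ y : R, x = (3:ℤ)^k • y ∧ ¬ ∃ z, y = (3:ℤ) • z := by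
  by_contra hcon
  push Not at hcon
  have key : ∀ k : ℕ, ∃ y : R, x = (3:ℤ)^k • y := by
    intro k
    induction k with
    | zero => exact ⟨x, by simp⟩
    | succ k ih =>
      obtain ⟨y, hy⟩ := ih
      obtain ⟨z, hz⟩ := hcon k y hy
      exact ⟨z, by rw [hy, hz, smul_smul, pow_succ]⟩
  let b := Module.Free.chooseBasis ℤ R
  apply hx
  apply b.repr.injective
  ext i
  simp only [map_zero, Finsupp.coe_zero, Pi.zero_apply]
  by_contra hne
  have hfin : FiniteMultiplicity (3:ℤ) (b.repr x i) := by
    rw [Int.finiteMultiplicity_iff]; exact ⟨by decide, hne⟩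
  obtain ⟨n, hn⟩ := hfin
  obtain ⟨y, hy⟩ := key (n+1)
  apply hn
  refine ⟨b.repr y i, ?_⟩
  conv_lhs => rw [hy]
  simp

theorem aux_inf {R : Type*} [Ring R] [Module.IsTorsionFree ℤ R] [Module.Finite ℤ R]
    (h : Infinite Rˣ) : ∃ u : Rˣ, ∀ n : ℕ, n ≠ 0 → u ^ n ≠ 1 := by
  let b := Module.Free.chooseBasis ℤ R
  let f : Rˣ → (Module.Free.ChooseBasisIndex ℤ R → ZMod 3) := fun u i => ((b.repr (u:R) i : ℤ) : ZMod 3)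
  obtain ⟨u, w, huw, hf⟩ := Finite.exists_ne_map_eq_of_infinite f
  have hd : ∀ i, (3:ℤ) ∣ b.repr (u:R) i - b.repr (w:R) i := by
    intro i
    have := congrFun hf i
    have h2 := (ZMod.intCast_eq_intCast_iff_dvd_sub _ _ 3).1 this.symm
    exact_mod_cast h2
  choose g hg using hd
  have hx : ∃ x : R, (u:R) - w = (3:ℤ) • x := by
    refine ⟨b.equivFun.symm g, ?_⟩
    apply b.equivFun.injective
    ext i
    rw [map_sub, map_smul, LinearEquiv.apply_symm_apply]
    simpa using hg i
  obtain ⟨x, hx⟩ := hx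
  have hne : x * (w⁻¹ : Rˣ) ≠ 0 := by
    intro h0
    have : x = 0 := by simpa using h0
    rw [this, smul_zero, sub_eq_zero] at hx
    exact huw (Units.ext hx)
  obtain ⟨k, y, hy, hy3⟩ := aux_div _ hne
  refine ⟨u * w⁻¹, fun n hn h1 => ?_⟩
  apply aux_tf n hn y (k+1) (by omega) hy3
  have : (1 + (3:ℤ)^(k+1) • y) = ((u * w⁻¹ : Rˣ) : R) := by
    have hu : (u:R) = w + (3:ℤ) • x := by rw [← hx]; abel
    rw [Units.val_mul, hu, add_mul, Units.mul_inv, smul_mul_assoc, hy, smul_smul, pow_succ, mul_comm]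
  rw [this, ← Units.val_pow_eq_pow_val, h1, Units.val_one]

theorem hasZxZ_of_commute {G : Type*} [Group G] (a b : G) (hab : Commute a b)
    (h : ∀ m n : ℤ, a ^ m * b ^ n = 1 → m = 0 ∧ n = 0) : HasZxZ G := by
  refine ⟨{ toFun := fun x => a ^ x.toAdd.1 * b ^ x.toAdd.2, map_one' := by simp, map_mul' := ?_ }, ?_⟩
  · intro x y
    simp only [toAdd_mul, Prod.fst_add, Prod.snd_add, zpow_add]
    have := (hab.zpow_zpow y.toAdd.1 x.toAdd.2).eq
    simp only [mul_assoc]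
    congr 1
    simp only [← mul_assoc]
    rw [this]
  · rw [injective_iff_map_eq_one]
    intro x hx
    obtain ⟨h1, h2⟩ := h _ _ hx
    exact Prod.ext h1 h2

theorem exists_int_smul_mem {A : Type*} [Ring A] [Algebra ℚ A] (L : AddSubgroup A)
    (hL : Submodule.span ℚ (L : Set A) = ⊤) (a : A) : ∃ n : ℤ, n ≠ 0 ∧ n • a ∈ L := by
  have ha : a ∈ Submodule.span ℚ (L : Set A) := by rw [hL]; trivial
  induction ha using Submodule.span_induction with
  | mem x hx => exact ⟨1, one_ne_zero, by simpa using hx⟩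
  | zero => exact ⟨1, one_ne_zero, by simp⟩
  | add x y _ _ hx hy =>
    obtain ⟨m, hm, hmx⟩ := hx
    obtain ⟨n, hn, hny⟩ := hy
    refine ⟨m * n, mul_ne_zero hm hn, ?_⟩
    have : (m * n) • (x + y) = n • (m • x) + m • (n • y) := by module
    rw [this]
    exact L.add_mem (L.zsmul_mem hmx _) (L.zsmul_mem hny _)
  | smul q x _ hx =>
    obtain ⟨m, hm, hmx⟩ := hx
    refine ⟨q.den * m, mul_ne_zero (by exact_mod_cast q.den_nz) hm, ?_⟩
    have : ((q.den : ℤ) * m) • (q • x) = q.num • (m • x) := by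
      simp only [← Int.cast_smul_eq_zsmul ℚ, smul_smul]
      congr 1
      push_cast
      have := q.den_mul_eq_num
      rw [← this]; ring
    rw [this]
    exact L.zsmul_mem hmx _

/-- Left order of a lattice. -/
def leftOrd {A : Type*} [Ring A] (L : AddSubgroup A) : Subring A where
  carrier := {a | ∀ x ∈ L, a * x ∈ L}
  mul_mem' := fun {a b} ha hb x hx => by rw [mul_assoc]; exact ha _ (hb _ hx)
  one_mem' := fun x hx => by simpa using hx
  add_mem' := fun {a b} ha hb x hx => by rw [add_mul]; exact L.add_mem (ha _ hx) (hb _ hx)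
  zero_mem' := fun x hx => by simp
  neg_mem' := fun {a} ha x hx => by rw [neg_mul]; exact L.neg_mem (ha _ hx)

theorem leftOrd_isZOrder {A : Type*} [Ring A] [Algebra ℚ A] (L : AddSubgroup A)
    (hfg : L.FG) (h1 : (1 : A) ∈ L) (hL : Submodule.span ℚ (L : Set A) = ⊤) :
    IsZOrder A (leftOrd L) := by
  constructor
  · have hle : (leftOrd L).toAddSubgroup ≤ L := fun a ha => by simpa using ha 1 h1
    have h2 : (AddSubgroup.toIntSubmodule L).FG := (Submodule.fg_iff_addSubgroup_fg (AddSubgroup.toIntSubmodule L)).2 hfg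
    have : IsNoetherian ℤ (AddSubgroup.toIntSubmodule L) := isNoetherian_of_fg_of_noetherian _ h2
    have h3 : AddSubgroup.toIntSubmodule (leftOrd L).toAddSubgroup ≤ AddSubgroup.toIntSubmodule L := hle
    exact (Submodule.fg_iff_addSubgroup_fg _).1 (Submodule.FG.of_le h2 h3)
  · rw [eq_top_iff]
    intro a _
    obtain ⟨S, hS⟩ := hfg
    have : ∀ S : Finset A, ∃ n : ℤ, n ≠ 0 ∧ ∀ s ∈ S, n • (a * s) ∈ L := by
      intro S
      classical
      induction S using Finset.induction_on with
      | empty => exact ⟨1, one_ne_zero, by simp⟩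
      | insert s S _ ih =>
        obtain ⟨n, hn, h⟩ := ih
        obtain ⟨m, hm, h'⟩ := exists_int_smul_mem L hL (a * s)
        refine ⟨n * m, mul_ne_zero hn hm, fun t ht => ?_⟩
        rcases Finset.mem_insert.1 ht with rfl | ht
        · rw [mul_smul]; exact L.zsmul_mem h' _
        · rw [mul_comm, mul_smul]; exact L.zsmul_mem (h t ht) _
    obtain ⟨n, hn, h⟩ := this S
    have hmem : n • a ∈ leftOrd L := by
      intro x hx
      rw [← hS] at hx
      induction hx using AddSubgroup.closure_induction with
      | mem x hx => rw [smul_mul_assoc]; exact h x hx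
      | zero => simp
      | add x y _ _ hx hy => rw [mul_add]; exact L.add_mem hx hy
      | neg x _ hx => rw [mul_neg]; exact L.neg_mem hx
    have : a = ((n:ℚ)⁻¹) • (n • a) := by
      rw [← Int.cast_smul_eq_zsmul ℚ, smul_smul, inv_mul_cancel₀ (by exact_mod_cast hn), one_smul]
    rw [this]
    exact Submodule.smul_mem _ _ (Submodule.subset_span hmem)

theorem exists_order {A : Type*} [Ring A] [Algebra ℚ A] [FiniteDimensional ℚ A] (v : Aˣ)
    (hv : IsIntegral ℤ (v : A)) (hv' : IsIntegral ℤ ((v⁻¹ : Aˣ) : A)) :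
    ∃ Γ : Subring A, IsZOrder A Γ ∧ (v : A) ∈ Γ ∧ ((v⁻¹ : Aˣ) : A) ∈ Γ := by
  let b := Module.finBasis ℚ A
  let E : Submodule ℤ A := Submodule.span ℤ (insert 1 (Set.range b))
  let P := Subalgebra.toSubmodule (Algebra.adjoin ℤ {(v : A)})
  let Q := Subalgebra.toSubmodule (Algebra.adjoin ℤ {((v⁻¹ : Aˣ) : A)})
  let L : Submodule ℤ A := P * Q * E
  have hE : E.FG := Submodule.fg_span ((Set.finite_range b).insert 1)
  have hfg : L.FG := (hv.fg_adjoin_singleton.mul hv'.fg_adjoin_singleton).mul hE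
  have hEL : E ≤ L := by
    intro x hx
    have : (1 : A) * 1 * x ∈ L := Submodule.mul_mem_mul (Submodule.mul_mem_mul
      (one_mem (Algebra.adjoin ℤ {(v : A)})) (one_mem (Algebra.adjoin ℤ {((v⁻¹ : Aˣ) : A)}))) hx
    simpa using this
  have hvP : ∀ p ∈ P, ((v⁻¹ : Aˣ) : A) * p = p * ((v⁻¹ : Aˣ) : A) := by
    intro p hp
    have hc : Commute (v : A) p := by
      have hp' : p ∈ Algebra.adjoin ℤ {(v : A)} := hp
      exact Algebra.commute_of_mem_adjoin_self hp'
    exact (hc.units_inv_left).eq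
  refine ⟨leftOrd L.toAddSubgroup, leftOrd_isZOrder _ ?_ ?_ ?_, ?_, ?_⟩
  · exact (Submodule.fg_iff_addSubgroup_fg L).1 hfg
  · exact hEL (Submodule.subset_span (Set.mem_insert _ _))
  · rw [eq_top_iff, ← b.span_eq]
    apply Submodule.span_mono
    rintro _ ⟨i, rfl⟩
    exact hEL (Submodule.subset_span (Set.mem_insert_of_mem _ ⟨i, rfl⟩))
  · intro x hx
    replace hx : x ∈ P * Q * E := hx
    show (v : A) * x ∈ P * Q * E
    rw [mul_assoc P Q E] at hx ⊢
    induction hx using Submodule.mul_induction_on' with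
    | mem_mul_mem p hp y hy =>
      rw [← mul_assoc (v : A)]
      exact Submodule.mul_mem_mul (mul_mem (S := Subalgebra ℤ A) (Algebra.self_mem_adjoin_singleton ℤ (v:A)) hp) hy
    | add x _ y _ hx hy => rw [mul_add]; exact Submodule.add_mem _ hx hy
  · intro x hx
    replace hx : x ∈ P * Q * E := hx
    show ((v⁻¹ : Aˣ) : A) * x ∈ P * Q * E
    rw [mul_assoc P Q E] at hx ⊢
    induction hx using Submodule.mul_induction_on' with
    | mem_mul_mem p hp y hy =>
      rw [← mul_assoc _ p y, hvP p hp, mul_assoc p]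
      refine Submodule.mul_mem_mul hp ?_
      clear hp
      induction hy using Submodule.mul_induction_on' with
      | mem_mul_mem p hp y hy =>
        rw [← mul_assoc]
        exact Submodule.mul_mem_mul (mul_mem (S := Subalgebra ℤ A) (Algebra.self_mem_adjoin_singleton ℤ ((v⁻¹ : Aˣ) : A)) hp) hy
      | add x _ y _ hx hy => rw [mul_add]; exact Submodule.add_mem _ hx hy
    | add x _ y _ hx hy => rw [mul_add]; exact Submodule.add_mem _ hx hy

/-- The unit `1 + z` for `z` of square zero. -/
def sqZeroUnit {R : Type*} [Ring R] (z : R) (hz : z * z = 0) : Rˣ where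
  val := 1 + z
  inv := 1 - z
  val_inv := by simp [mul_sub, add_mul, hz]
  inv_val := by simp [mul_add, sub_mul, hz]

theorem sqZeroUnit_zpow {R : Type*} [Ring R] (z : R) (hz : z * z = 0) (n : ℤ) :
    ((sqZeroUnit z hz ^ n : Rˣ) : R) = 1 + n • z := by
  induction n using Int.induction_on with
  | zero => simp
  | succ n ih =>
    rw [zpow_add_one, Units.val_mul, ih]
    show (1 + (n:ℤ) • z) * (1 + z) = _
    simp only [mul_add, add_mul, smul_mul_assoc, hz, mul_one, one_mul, smul_zero]
    module
  | pred n ih =>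
    rw [zpow_sub_one, Units.val_mul, ih]
    show (1 + (-(n:ℤ)) • z) * (1 - z) = _
    simp only [mul_sub, add_mul, smul_mul_assoc, hz, mul_one, one_mul, smul_zero]
    module

theorem isIntegral_lift_s4 {A B : Type*} [Ring A] [Ring B] (π : A →+* B) 
    (hnil : ∀ a, π a = 0 → IsNilpotent a) (a : A) (h : IsIntegral ℤ (π a)) : IsIntegral ℤ a := by
  obtain ⟨p, hp, h0⟩ := h
  have h1 : π (Polynomial.aeval a p) = 0 := by
    rw [← Polynomial.aeval_def] at h0
    rw [← h0]
    exact (Polynomial.aeval_algHom_apply π.toIntAlgHom a p).symm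
  obtain ⟨n, hn⟩ := hnil _ h1
  refine ⟨p ^ n, hp.pow n, ?_⟩
  rw [← Polynomial.aeval_def, map_pow, hn]

theorem eigen_integral {A : Type*} [Ring A] [Algebra ℚ A] (f : A →+ A) (v : A) 
    (c : ℚ) (z : A) (hz : z ≠ 0) 
    (hf : ∀ p : Polynomial ℤ, f (Polynomial.aeval v p) = (Polynomial.aeval c p) • z)
    (hv : IsIntegral ℤ v) : ∃ m : ℤ, c = m := by
  obtain ⟨p, hp, h0⟩ := hv
  have h1 := hf p
  rw [← Polynomial.aeval_def] at h0
  rw [h0, map_zero] at h1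
  have h2 : Polynomial.aeval c p = 0 := by
    rcases smul_eq_zero.1 h1.symm with h | h
    · exact h
    · exact absurd h hz
  have : IsIntegral ℤ c := ⟨p, hp, by rw [← Polynomial.aeval_def]; exact h2⟩
  obtain ⟨m, hm⟩ := IsIntegrallyClosed.isIntegral_iff.1 this
  exact ⟨m, by simpa using hm.symm⟩

theorem eigen_left {A : Type*} [Ring A] [Algebra ℚ A] (v : A) 
    (c : ℚ) (z : A) (hz : z ≠ 0) (h : v * z = c • z)
    (hv : IsIntegral ℤ v) : ∃ m : ℤ, c = m := by
  refine eigen_integral (AddMonoidHom.mulRight z) v c z hz ?_ hv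
  intro p
  simp only [AddMonoidHom.mulRight_apply]
  induction p using Polynomial.induction_on' with
  | add p q hp hq => simp only [map_add, add_mul, add_smul, hp, hq]
  | monomial n a =>
    have : ∀ n : ℕ, v ^ n * z = c ^ n • z := by
      intro n
      induction n with
      | zero => simp
      | succ n ih => rw [pow_succ, mul_assoc, h, mul_smul_comm, ih, smul_smul, pow_succ, mul_comm]
    simp only [Polynomial.aeval_monomial, mul_assoc, this]
    simp [Algebra.smul_def, mul_assoc]

theorem eigen_right {A : Type*} [Ring A] [Algebra ℚ A] (v : A) 
    (c : ℚ) (z : A) (hz : z ≠ 0) (h : z * v = c • z)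
    (hv : IsIntegral ℤ v) : ∃ m : ℤ, c = m := by
  refine eigen_integral (AddMonoidHom.mulLeft z) v c z hz ?_ hv
  intro p
  simp only [AddMonoidHom.coe_mulLeft]
  induction p using Polynomial.induction_on' with
  | add p q hp hq => simp only [map_add, mul_add, add_smul, hp, hq]
  | monomial n a =>
    have : ∀ n : ℕ, z * v ^ n = c ^ n • z := by
      intro n
      induction n with
      | zero => simp
      | succ n ih => rw [pow_succ, ← mul_assoc, ih, smul_mul_assoc, h, smul_smul, pow_succ]
    simp only [Polynomial.aeval_monomial]
    rw [Algebra.commutes a (v^n), ← mul_assoc, this, ← Algebra.commutes]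
    simp [Algebra.smul_def, mul_assoc]

theorem int_sq_one {c d : ℚ} (hcd : c * d = 1) (hc : ∃ m : ℤ, c = m) (hd : ∃ m : ℤ, d = m) :
    c * c = 1 := by
  obtain ⟨m, rfl⟩ := hc
  obtain ⟨n, rfl⟩ := hd
  have : m * n = 1 := by exact_mod_cast hcd
  rcases Int.eq_one_or_neg_one_of_mul_eq_one this with rfl | rfl <;> norm_num

theorem hasZxZ_sq {R : Type*} [Ring R] (z w : R) (hz : z * z = 0) (hw : w * w = 0)
    (hzw : z * w = 0) (hwz : w * z = 0)
    (h : ∀ m n : ℤ, m • z + n • w = 0 → m = 0 ∧ n = 0) : HasZxZ Rˣ := by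
  refine hasZxZ_of_commute (sqZeroUnit z hz) (sqZeroUnit w hw) ?_ ?_
  · apply Units.ext
    show (1 + z) * (1 + w) = (1 + w) * (1 + z)
    simp only [mul_add, add_mul, hzw, hwz, mul_one, one_mul]
    abel
  · intro m n hmn
    apply h
    have := congrArg Units.val hmn
    rw [Units.val_mul, sqZeroUnit_zpow, sqZeroUnit_zpow] at this
    simp only [mul_add, add_mul, smul_mul_assoc, mul_smul_comm, hzw, mul_one, one_mul, smul_zero,
      Units.val_one, add_zero] at this
    rw [add_assoc] at this
    simpa using this

theorem exists_sq_zero_ideal {A : Type*} [Ring A] [IsArtinianRing A] 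
    (hne : Ring.jacobson A ≠ ⊥) : ∃ N : Ideal A, N.IsTwoSided ∧ N ≠ ⊥ ∧ N ≤ Ring.jacobson A ∧ 
      ∀ x ∈ N, ∀ y ∈ N, x * y = 0 := by
  classical
  have hnil : ∃ n, (Ring.jacobson A)^n = ⊥ := IsSemiprimaryRing.isNilpotent
  have hn := Nat.find_spec hnil
  have hmin := fun m => Nat.find_min hnil (m := m)
  set n := Nat.find hnil
  rcases n with _ | m
  · exfalso
    rw [Submodule.pow_zero, Ideal.one_eq_top] at hn
    exact hne (eq_bot_iff.2 (hn ▸ le_top))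
  have hm : m ≠ 0 := by
    rintro rfl
    apply hne
    rwa [zero_add, Submodule.pow_one] at hn
  have hle : (Ring.jacobson A)^m ≤ Ring.jacobson A := Ideal.pow_le_self hm
  refine ⟨(Ring.jacobson A)^m, inferInstance, hmin m (Nat.lt_succ_self m), hle, ?_⟩
  intro x hx y hy
  have : x * y ∈ (Ring.jacobson A)^(m+1) := by
    rw [Submodule.pow_succ]
    exact Ideal.mul_mem_mul hx (hle hy)
  rw [hn] at this
  simpa using this

theorem nilp_of_mem_jac {A : Type*} [Ring A] [IsArtinianRing A] (a : A) 
    (ha : a ∈ Ring.jacobson A) : IsNilpotent a := by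
  obtain ⟨n, hn⟩ : ∃ n, (Ring.jacobson A)^n = ⊥ := IsSemiprimaryRing.isNilpotent
  refine ⟨n, ?_⟩
  have : ∀ k, a ^ k ∈ (Ring.jacobson A)^k := by
    intro k
    induction k with
    | zero => rw [Submodule.pow_zero, Ideal.one_eq_top]; trivial
    | succ k ih => rw [pow_succ, Submodule.pow_succ]; exact Ideal.mul_mem_mul ih ha
  have h := this n
  rw [hn] at h
  simpa using h

theorem core {A B : Type*} [Ring A] [Algebra ℚ A] [FiniteDimensional ℚ A] [Ring B] [Algebra ℚ B]
    (hA : HasHyperbolicProperty A) (π : A →+* B) (hπ : Function.Surjective π)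
    (hker : ∀ a, π a = 0 ↔ a ∈ Ring.jacobson A) (hne : Ring.jacobson A ≠ ⊥)
    (Γ : Subring B) (hΓ : IsZOrder B Γ) : Finite Γˣ := by
  by_contra hinf
  rw [not_finite_iff_infinite] at hinf
  have : IsArtinianRing A := IsArtinianRing.of_finite ℚ A
  have hnil : ∀ a, π a = 0 → IsNilpotent a := fun a ha => nilp_of_mem_jac a ((hker a).1 ha)
  have hfin : Module.Finite ℤ Γ :=
    Module.Finite.iff_addGroup_fg.2 ((AddGroup.fg_iff_addSubgroup_fg Γ.toAddSubgroup).2 hΓ.1)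
  have htfA : Module.IsTorsionFree ℤ A := Module.IsTorsionFree.trans ℚ
  have htfB : Module.IsTorsionFree ℤ B := Module.IsTorsionFree.trans ℚ
  have htf : Module.IsTorsionFree ℤ Γ := 
    Function.Injective.moduleIsTorsionFree (Γ.subtype : Γ → B) Subtype.val_injective (fun _ _ => rfl)
  obtain ⟨u, hu⟩ := aux_inf hinf
  obtain ⟨a, ha⟩ := hπ (u : Γ)
  obtain ⟨a', ha'⟩ := hπ ((u⁻¹ : Γˣ) : Γ)
  have hunit : ∀ x, π x = 1 → IsUnit x := by
    intro x hx
    have : IsNilpotent (x - 1) := hnil _ (by rw [map_sub, hx, map_one, sub_self])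
    simpa using this.isUnit_one_add
  have h1 : IsUnit (a * a') := hunit _ (by
    rw [map_mul, ha, ha']; exact_mod_cast congrArg Subtype.val (Units.mul_inv u))
  have h2 : IsUnit (a' * a) := hunit _ (by
    rw [map_mul, ha, ha']; exact_mod_cast congrArg Subtype.val (Units.inv_mul u))
  have hau : IsUnit a := by
    obtain ⟨s, hs⟩ := h1.exists_right_inv
    obtain ⟨t, ht⟩ := h2.exists_left_inv
    rw [mul_assoc] at hs
    rw [← mul_assoc] at ht
    exact ⟨⟨a, a' * s, hs, by rwa [← left_inv_eq_right_inv ht hs]⟩, rfl⟩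
  obtain ⟨v, rfl⟩ := hau
  have hv' : π ((v⁻¹ : Aˣ) : A) = ((u⁻¹ : Γˣ) : Γ) := by
    have e1 : π ((v⁻¹ : Aˣ) : A) * π v = 1 := by rw [← map_mul]; simp
    have e2 : π v * ((u⁻¹ : Γˣ) : Γ) = 1 := by
      rw [ha]; exact_mod_cast congrArg Subtype.val (Units.mul_inv u)
    exact left_inv_eq_right_inv e1 e2
  have hint : ∀ g : Γ, IsIntegral ℤ (g : B) := fun g =>
    (IsIntegral.of_finite ℤ g).map Γ.subtype.toIntAlgHom
  have hvi : IsIntegral ℤ (v : A) := isIntegral_lift_s4 π hnil _ (by rw [ha]; exact hint _)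
  have hvi' : IsIntegral ℤ ((v⁻¹ : Aˣ) : A) := isIntegral_lift_s4 π hnil _ (by rw [hv']; exact hint _)
  obtain ⟨Λ, hΛ, hvΛ, hvΛ'⟩ := exists_order v hvi hvi'
  obtain ⟨N, hN2, hNne, hNJ, hNN⟩ := exists_sq_zero_ideal hne
  obtain ⟨z, hzN, hz0⟩ := Submodule.exists_mem_ne_zero_of_ne_bot hNne
  obtain ⟨k, hk, hkz⟩ := exists_int_smul_mem Λ.toAddSubgroup hΛ.2 z
  have hone : ∀ w ∈ N, ∃ c : ℚ, w = c • z := by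
    intro w hwN
    by_contra hcon
    push Not at hcon
    obtain ⟨l, hl, hlw⟩ := exists_int_smul_mem Λ.toAddSubgroup hΛ.2 w
    refine hA Λ hΛ (hasZxZ_sq (⟨k • z, hkz⟩ : Λ) ⟨l • w, hlw⟩ ?_ ?_ ?_ ?_ ?_)
    · apply Subtype.ext; show (k • z) * (k • z) = 0; rw [smul_mul_assoc, mul_smul_comm, hNN z hzN z hzN, smul_zero, smul_zero]
    · apply Subtype.ext; show (l • w) * (l • w) = 0; rw [smul_mul_assoc, mul_smul_comm, hNN w hwN w hwN, smul_zero, smul_zero]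
    · apply Subtype.ext; show (k • z) * (l • w) = 0; rw [smul_mul_assoc, mul_smul_comm, hNN z hzN w hwN, smul_zero, smul_zero]
    · apply Subtype.ext; show (l • w) * (k • z) = 0; rw [smul_mul_assoc, mul_smul_comm, hNN w hwN z hzN, smul_zero, smul_zero]
    · intro m n hmn
      have e : m • (k • z) + n • (l • w) = 0 := congrArg Subtype.val hmn
      have hn : n = 0 := by
        by_contra hn
        apply hcon (-((n * l : ℤ) : ℚ)⁻¹ * ((m * k : ℤ) : ℚ))
        have hnl : ((n * l : ℤ) : ℚ) ≠ 0 := by exact_mod_cast mul_ne_zero hn hl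
        have e2 : ((n * l : ℤ) : ℚ) • w = -(((m * k : ℤ) : ℚ) • z) := by
          rw [Int.cast_smul_eq_zsmul, Int.cast_smul_eq_zsmul, mul_smul, mul_smul]
          exact eq_neg_of_add_eq_zero_right e
        rw [neg_mul, neg_smul, mul_smul, ← smul_neg, ← e2, smul_smul, inv_mul_cancel₀ hnl, one_smul]
      subst hn
      rw [zero_smul, add_zero, smul_smul] at e
      rcases smul_eq_zero.1 e with h | h
      · exact ⟨(mul_eq_zero.1 h).resolve_right hk, rfl⟩
      · exact absurd h hz0
  have hl : (v : A) * ((v : A) * z) = z := by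
    obtain ⟨c, hc⟩ := hone _ (N.mul_mem_left (v : A) hzN)
    obtain ⟨d, hd⟩ := hone _ (N.mul_mem_left ((v⁻¹ : Aˣ) : A) hzN)
    have hcd : c * d = 1 := by
      have : (v : A) * (((v⁻¹ : Aˣ) : A) * z) = z := by simp
      rw [hd, mul_smul_comm, hc, smul_smul, mul_comm] at this
      exact smul_left_injective ℚ hz0 (by simpa using this)
    have := int_sq_one hcd (eigen_left _ c z hz0 hc hvi) (eigen_left _ d z hz0 hd hvi')
    rw [hc, mul_smul_comm, hc, smul_smul, this, one_smul]
  have hr : z * (v : A) * (v : A) = z := by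
    obtain ⟨c, hc⟩ := hone _ (N.mul_mem_right (v : A) hzN)
    obtain ⟨d, hd⟩ := hone _ (N.mul_mem_right ((v⁻¹ : Aˣ) : A) hzN)
    have hcd : c * d = 1 := by
      have : z * ((v⁻¹ : Aˣ) : A) * (v : A) = z := by simp
      rw [hd, smul_mul_assoc, hc, smul_smul, mul_comm] at this
      exact smul_left_injective ℚ hz0 (by simpa using this)
    have := int_sq_one hcd (eigen_right _ c z hz0 hc hvi) (eigen_right _ d z hz0 hd hvi')
    rw [hc, smul_mul_assoc, hc, smul_smul, this, one_smul]
  let V : Λˣ := ⟨⟨v, hvΛ⟩, ⟨_, hvΛ'⟩, Subtype.ext (Units.mul_inv v), Subtype.ext (Units.inv_mul v)⟩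
  let Z : Λ := ⟨k • z, hkz⟩
  have hZZ : Z * Z = 0 := by
    apply Subtype.ext; show (k • z) * (k • z) = 0; rw [smul_mul_assoc, mul_smul_comm, hNN z hzN z hzN, smul_zero, smul_zero]
  refine hA Λ hΛ (hasZxZ_of_commute (V * V) (sqZeroUnit Z hZZ) ?_ ?_)
  · apply Units.ext
    apply Subtype.ext
    show ((v : A) * v) * (1 + k • z) = (1 + k • z) * ((v : A) * v)
    rw [mul_add, add_mul, mul_smul_comm, smul_mul_assoc, mul_assoc (v : A) v z, hl, 
      ← mul_assoc z, hr, mul_one, one_mul]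
  · intro m n hmn
    let φ : Λ →* B := (π.comp Λ.subtype : Λ →+* B)
    have hm : m = 0 := by
      have e := congrArg (Units.map φ) hmn
      have eZ : Units.map φ (sqZeroUnit Z hZZ) = 1 := by
        apply Units.ext
        show π (1 + k • z) = 1
        rw [map_add, map_one, map_zsmul, (hker z).2 (hNJ hzN), smul_zero, add_zero]
      have eV : Units.map φ V = Units.map (Γ.subtype : Γ →* B) u := by
        apply Units.ext
        exact ha
      rw [map_mul, map_zpow, map_zpow, map_mul, eZ, eV, one_zpow, mul_one, map_one, ← map_mul,
        ← map_zpow] at e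
      have hinj : Function.Injective (Units.map (Γ.subtype : Γ →* B)) :=
        Units.map_injective Subtype.val_injective
      have e3 : (u * u) ^ m = 1 := hinj (by rw [e, map_one])
      by_contra hm
      have e4 : (u * u) ^ m.natAbs = 1 := by
        rcases Int.natAbs_eq m with h | h
        · rw [h, zpow_natCast] at e3; exact e3
        · rw [h, zpow_neg, zpow_natCast, inv_eq_one] at e3; exact e3
      apply hu (2 * m.natAbs) (by omega)
      rw [pow_mul, pow_two]; exact e4
    subst hm
    refine ⟨rfl, ?_⟩
    rw [zpow_zero, one_mul] at hmn
    have e := congrArg Units.val hmn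
    rw [sqZeroUnit_zpow, Units.val_one] at e
    have e2 : n • Z = 0 := by simpa using e
    have e3 : n • (k • z) = 0 := congrArg Subtype.val e2
    rw [smul_smul] at e3
    rcases smul_eq_zero.1 e3 with h | h
    · exact (mul_eq_zero.1 h).resolve_right hk
    · exact absurd h hz0

theorem finite_units_of_orders_in_semisimple_quotient
    (A : Type*) [Ring A] [Algebra ℚ A] [FiniteDimensional ℚ A]
    (hA : HasHyperbolicProperty A)
    (J : TwoSidedIdeal A) (hJ : TwoSidedIdeal.asIdeal J = (⊥ : Ideal A).jacobson)
    (hJne : J ≠ ⊥) :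
    ∀ Γ : Subring J.ringCon.Quotient, IsZOrder J.ringCon.Quotient Γ → Finite Γˣ := by
  rw [Ideal.jacobson_bot] at hJ
  have hmem : ∀ a, a ∈ J ↔ a ∈ Ring.jacobson A := fun a => by
    rw [← hJ, TwoSidedIdeal.mem_asIdeal]
  refine core hA (J.ringCon.mk' : A →+* J.ringCon.Quotient) J.ringCon.mk'_surjective ?_ ?_
  · intro a
    rw [← hmem, TwoSidedIdeal.mem_iff]
    exact J.ringCon.eq (a := a) (b := 0)
  · intro h
    apply hJne
    ext a
    rw [hmem, h]
    simp
end

section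
/- Let H be a nontrivial finite abelian group. The rational group algebra ℚ[H] has the hyperbolic property if and only if the exponent of H divides 4 or 6, or H is cyclic of order 5, 8, or 12. -/
open NumberField 

theorem hyp_L1 (K : Type*) [Field K] [NumberField K] (h : 2 ≤ Units.rank K) :
    ∃ f : Multiplicative (ℤ × ℤ) →* (𝓞 K)ˣ, Function.Injective f := by
  rw [← Units.finrank_eq] at h
  obtain ⟨w, hw⟩ := exists_linearIndependent_of_le_finrank h
  refine ⟨AddMonoidHom.toMultiplicativeLeft (AddMonoidHom.mk' (fun x : ℤ × ℤ => x.1 • w 0 + x.2 • w 1) ?_), ?_⟩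
  · intro x y
    simp only [Prod.fst_add, Prod.snd_add]
    rw [add_zsmul, add_zsmul]
    exact add_add_add_comm (x.1 • w 0) _ _ _
  · rw [injective_iff_map_eq_one]
    intro x hx
    change (x.toAdd.1) • w 0 + (x.toAdd.2) • w 1 = 0 at hx
    have h3 := Fintype.linearIndependent_iff.1 hw ![x.toAdd.1, x.toAdd.2] (by simpa using hx)
    exact Prod.ext (h3 0) (h3 1)

theorem hyp_L4 (K : Type*) [Field K] [NumberField K] (h : Units.rank K = 0) (u : (𝓞 K)ˣ) : IsOfFinOrder u := by
  obtain ⟨⟨ζ, e⟩, h1, -⟩ := Units.exist_unique_eq_mul_prod K u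
  have : IsEmpty (Fin (Units.rank K)) := by rw [h]; infer_instance
  simp at h1
  rw [h1]
  exact ζ.2

theorem hyp_L2 (K : Type*) [Field K] [NumberField K] (h : 1 ≤ Units.rank K) :
    ∃ u : (𝓞 K)ˣ, ∀ n : ℤ, u ^ n = 1 → n = 0 := by
  rw [← Units.finrank_eq] at h
  obtain ⟨w, hw⟩ := exists_linearIndependent_of_le_finrank h
  refine ⟨(w 0).toMul, fun n hn => ?_⟩
  have h2 : n • w 0 = 0 := hn
  have h3 := Fintype.linearIndependent_iff.1 hw ![n] (by simpa using h2)
  exact h3 0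

theorem hyp_L3 (K : Type*) [Field K] [NumberField K] (h : Units.rank K ≤ 1)
    (f : Multiplicative (ℤ × ℤ) →* (𝓞 K)ˣ) : ∃ x, x ≠ 1 ∧ f x = 1 := by
  let g : (ℤ × ℤ) →ₗ[ℤ] Additive ((𝓞 K)ˣ) :=
    (MonoidHom.toAdditiveRight f).toIntLinearMap
  have : ¬ Function.Injective g := by
    intro hg
    have := LinearMap.finrank_le_finrank_of_injective hg
    rw [Units.finrank_eq] at this
    simp at this
    omega
  rw [injective_iff_map_eq_zero] at this
  push Not at this
  obtain ⟨a, ha, ha0⟩ := this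
  exact ⟨Multiplicative.ofAdd a, by simpa using ha0, ha⟩

theorem hyp_totient (n : ℕ) (h0 : 0 < n) (h : Nat.totient n / 2 - 1 ≤ 1) :
    n ∈ ({1,2,3,4,5,6,8,10,12} : Finset ℕ) := by
  have h4 : Nat.totient n < 6 := by omega
  have key : ∀ p : ℕ, p.Prime → ∀ k, p ^ (k+1) ∣ n → p ^ k * (p - 1) ≤ 5 := by
    intro p hp k hk
    rw [← Nat.totient_prime_pow_succ hp]
    exact (Nat.le_of_dvd (Nat.totient_pos.2 h0) (Nat.totient_dvd_of_dvd hk)).trans (by omega)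
  have hb : n ∣ 120 := by
    rw [Nat.dvd_iff_prime_pow_dvd_dvd]
    intro p k hp hk
    rcases k with _ | j
    · simp
    have h1 := key p hp j hk
    have hp2 := hp.two_le
    have hj : j ≤ 2 := by
      by_contra hj
      have h3 : 2 ^ 3 ≤ p ^ j := (Nat.pow_le_pow_left hp2 3).trans (Nat.pow_le_pow_right (by omega) (by omega))
      have : p ^ j * 1 ≤ p ^ j * (p - 1) := Nat.mul_le_mul_left _ (by omega)
      omega
    have hp6 : p ≤ 6 := by
      have : 1 * (p - 1) ≤ p ^ j * (p - 1) := Nat.mul_le_mul_right _ (Nat.one_le_pow _ _ (by omega))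
      omega
    interval_cases p <;> interval_cases j <;> (revert h1; decide)
  have hn : n ≤ 120 := Nat.le_of_dvd (by norm_num) hb
  revert h4
  have : n ∈ Nat.divisors 120 := by simpa using hb
  have e : Nat.divisors 120 = {1,2,3,4,5,6,8,10,12,15,20,24,30,40,60,120} := by decide
  rw [e] at this
  simp only [Finset.mem_insert, Finset.mem_singleton] at this
  rcases this with h|h|h|h|h|h|h|h|h|h|h|h|h|h|h|h <;> subst h <;> decide

theorem hyp_group (H : Type*) [CommGroup H] [Finite H]
    (h1 : ∀ g : H, Nat.totient (orderOf g) / 2 - 1 ≤ 1)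
    (h2 : ∀ g h : H, Nat.totient (orderOf g) / 2 - 1 ≠ 0 → Nat.totient (orderOf h) / 2 - 1 ≠ 0 →
      h ∈ Subgroup.zpowers g) :
    (Monoid.exponent H ∣ 4 ∨ Monoid.exponent H ∣ 6 ∨
        (IsCyclic H ∧ (Nat.card H = 5 ∨ Nat.card H = 8 ∨ Nat.card H = 12))) := by
  obtain ⟨g, hg⟩ := Monoid.exists_orderOf_eq_exponent (G := H) (Monoid.ExponentExists.of_finite)
  have hpow : ∀ h : H, h ^ orderOf g = 1 := fun h => by rw [hg]; exact Monoid.pow_exponent_eq_one h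
  have key : Nat.totient (orderOf g) / 2 - 1 ≠ 0 → (∀ h : H, h ∈ Subgroup.zpowers g) →
      IsCyclic H ∧ Nat.card H = orderOf g := by
    intro _ h
    exact ⟨⟨g, h⟩, (orderOf_eq_card_of_forall_mem_zpowers h).symm⟩
  have mulmem : ∀ k : ℕ, ∀ h : H, g ^ k * h ∈ Subgroup.zpowers g → h ∈ Subgroup.zpowers g := by
    intro k h hm
    exact (Subgroup.mul_mem_cancel_left _ (Subgroup.npow_mem_zpowers g k)).1 hm
  have hm := hyp_totient (orderOf g) (orderOf_pos g) (h1 g)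
  rw [← hg]
  simp only [Finset.mem_insert, Finset.mem_singleton] at hm
  rcases hm with e|e|e|e|e|e|e|e|e <;> rw [e] at key hpow
  · simp [e]
  · left; rw [e]; norm_num
  · right; left; rw [e]; norm_num
  · simp [e]
  · right; right
    have := key (by decide) (fun h => by
      by_cases hh : h = 1
      · subst hh; exact one_mem _
      have : Fact (Nat.Prime 5) := ⟨by norm_num⟩
      have : orderOf h = 5 := orderOf_eq_prime (hpow h) hh
      apply h2 _ _ (by rw [e]; decide) (by rw [this]; decide))
    tauto
  · simp [e]
  · right; right
    have := key (by decide) (fun h => by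
      by_cases hh : h ^ 4 = 1
      · apply mulmem 1
        have : orderOf (g ^ 1 * h) = 2 ^ (2 + 1) := by
          apply orderOf_eq_prime_pow
          · rw [mul_pow, ← pow_mul, show 2 ^ 2 = 4 from rfl, hh, mul_one]
            intro h
            have := orderOf_dvd_of_pow_eq_one h
            rw [e] at this; revert this; decide
          · exact hpow _
        apply h2 _ _ (by rw [e]; decide) (by rw [this]; decide)
      · have : orderOf (h) = 2 ^ (2 + 1) := by
          apply orderOf_eq_prime_pow
          · exact hh
          · exact hpow _
        apply h2 _ _ (by rw [e]; decide) (by rw [this]; decide))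
    tauto
  · exfalso
    have h5 : orderOf (g ^ 2) = 5 := by rw [orderOf_pow, e]; rfl
    have := h2 (g ^ 2) g (by rw [h5]; decide) (by rw [e]; decide)
    have := orderOf_dvd_of_mem_zpowers this
    rw [h5, e] at this
    revert this; decide
  · right; right
    have ord12 : ∀ x : H, x ^ 4 ≠ 1 → x ^ 6 ≠ 1 → orderOf x = 12 := by
      intro x h4 h6
      have : orderOf x ∈ Nat.divisors 12 := by simpa using orderOf_dvd_of_pow_eq_one (hpow x)
      have e' : Nat.divisors 12 = {1,2,3,4,6,12} := by decide
      rw [e'] at this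
      simp only [Finset.mem_insert, Finset.mem_singleton] at this
      have h4' : ¬ orderOf x ∣ 4 := fun h => h4 (orderOf_dvd_iff_pow_eq_one.1 h)
      have h6' : ¬ orderOf x ∣ 6 := fun h => h6 (orderOf_dvd_iff_pow_eq_one.1 h)
      rcases this with h|h|h|h|h|h <;> rw [h] at h4' h6' <;> first | exact h | (exfalso; revert h4' h6'; decide)
    have mem12 : ∀ x : H, x ^ 4 ≠ 1 → x ^ 6 ≠ 1 → x ∈ Subgroup.zpowers g := by
      intro x h4 h6
      apply h2 _ _ (by rw [e]; decide) (by rw [ord12 x h4 h6]; decide)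
    have gne : ∀ k : ℕ, ¬ 12 ∣ k → g ^ k ≠ 1 := by
      intro k hk h
      have := orderOf_dvd_of_pow_eq_one h
      rw [e] at this; exact hk this
    have m3 : ∀ a : H, a ^ 3 = 1 → a ∈ Subgroup.zpowers g := by
      intro a ha
      by_cases h1 : a = 1
      · subst h1; exact one_mem _
      apply mulmem 3
      apply mem12
      · rw [mul_pow, ← pow_mul, show (3 * 4) = 12 from rfl, hpow, one_mul, pow_succ, ha, one_mul]
        exact h1
      · rw [mul_pow, ← pow_mul, show a ^ 6 = (a ^ 3) ^ 2 by rw [← pow_mul], ha, one_pow, mul_one]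
        exact gne _ (by decide)
    have m4 : ∀ a : H, a ^ 4 = 1 → a ∈ Subgroup.zpowers g := by
      intro a ha
      by_cases h1 : a ^ 2 = 1
      · apply mulmem 1
        apply mem12
        · rw [mul_pow, ← pow_mul, ha, mul_one]
          exact gne _ (by decide)
        · rw [mul_pow, ← pow_mul, show a ^ 6 = (a ^ 2) ^ 3 by rw [← pow_mul], h1, one_pow, mul_one]
          exact gne _ (by decide)
      · apply mulmem 4
        apply mem12
        · rw [mul_pow, ← pow_mul, ha, mul_one]
          exact gne _ (by decide)
        · rw [mul_pow, ← pow_mul, show a ^ 6 = a ^ 4 * a ^ 2 by rw [← pow_add], ha, one_mul,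
            show 4 * 6 = 12 * 2 from rfl, pow_mul, hpow, one_pow, one_mul]
          exact h1
    have := key (by decide) (fun h => by
      have : h = h ^ 4 * (h ^ 3)⁻¹ := by rw [pow_succ' h 3]; group
      rw [this]
      apply mul_mem
      · apply m3; rw [← pow_mul]; exact hpow h
      · apply inv_mem; apply m4; rw [← pow_mul]; exact hpow h)
    tauto

theorem hyp_order_hom {A K : Type*} [CommRing A] [Algebra ℚ A] [Field K] [NumberField K]
    (p : A →+* K) (Γ : Subring A) (hΓ : IsZOrder A Γ) :
    ∃ q : Γ →+* 𝓞 K, ∀ x, ((q x : 𝓞 K) : K) = p x := by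
  have hfin : Module.Finite ℤ Γ := by
    have h1 : AddGroup.FG Γ.toAddSubgroup := (AddGroup.fg_iff_addSubgroup_fg _).2 hΓ.1
    exact Module.Finite.iff_addGroup_fg.2 h1
  have hint : Algebra.IsIntegral ℤ Γ := Algebra.IsIntegral.of_finite ℤ Γ
  let q0 : Γ →+* K := p.comp Γ.subtype
  have hq : ∀ x, q0 x ∈ integralClosure ℤ K := by
    intro x
    exact (hint.isIntegral x).map q0.toIntAlgHom
  exact ⟨q0.codRestrict (integralClosure ℤ K) hq, fun x => rfl⟩

theorem hyp_backward {A ι : Type*} [CommRing A] [Algebra ℚ A] [Fintype ι] [Nonempty ι]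
    (K : ι → Type*) [∀ i, Field (K i)] [∀ i, NumberField (K i)] (e : A →+* ∀ i, K i)
    (he : Function.Injective e)
    (h1 : ∀ i, Units.rank (K i) ≤ 1)
    (h2 : ∀ i j, Units.rank (K i) ≠ 0 → Units.rank (K j) ≠ 0 → i = j) :
    HasHyperbolicProperty A := by
  rintro Γ hΓ ⟨f, hf⟩
  choose q hq using fun i => hyp_order_hom ((Pi.evalRingHom K i).comp e) Γ hΓ
  let F : ∀ i, Multiplicative (ℤ × ℤ) →* (𝓞 (K i))ˣ := fun i => (Units.map (q i : Γ →* 𝓞 (K i))).comp f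
  have hF : ∀ x, (∀ i, F i x = 1) → x = 1 := by
    intro x hx
    apply hf
    rw [map_one]
    ext
    apply he
    funext i
    have := congrArg (fun u : (𝓞 (K i))ˣ => ((u : 𝓞 (K i)) : K i)) (hx i)
    simpa [F, hq] using this
  obtain ⟨x, hx1, hx⟩ : ∃ x, x ≠ 1 ∧ ∀ i, IsOfFinOrder (F i x) := by
    by_cases h : ∃ i, Units.rank (K i) ≠ 0
    · obtain ⟨i, hi⟩ := h
      obtain ⟨x, hx1, hx⟩ := hyp_L3 (K i) (h1 i) (F i)
      refine ⟨x, hx1, fun j => ?_⟩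
      by_cases hj : Units.rank (K j) = 0
      · exact hyp_L4 _ hj _
      · obtain rfl := h2 i j hi hj
        rw [hx]; exact IsOfFinOrder.one
    · push Not at h
      exact ⟨Multiplicative.ofAdd (1, 0), by simp [← ofAdd_zero], fun j => hyp_L4 _ (h j) _⟩
  let N := ∏ i, orderOf (F i x)
  have hN : N ≠ 0 := Finset.prod_ne_zero_iff.2 fun i _ => (hx i).orderOf_pos.ne'
  have : x ^ N = 1 := by
    apply hF
    intro i
    rw [map_pow]
    exact orderOf_dvd_iff_pow_eq_one.1 (Finset.dvd_prod_of_mem _ (Finset.mem_univ i))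
  have h3 : N • x.toAdd = 0 := this
  exact hx1 ((smul_eq_zero.1 h3).resolve_left hN)

theorem hyp_forward {A ι : Type*} [CommRing A] [Algebra ℚ A] [Fintype ι]
    (K : ι → Type*) [∀ i, Field (K i)] [∀ i, NumberField (K i)] (e : A ≃+* ∀ i, K i)
    (hA : HasHyperbolicProperty A) :
    (∀ i, Units.rank (K i) ≤ 1) ∧
    (∀ i j, Units.rank (K i) ≠ 0 → Units.rank (K j) ≠ 0 → i = j) := by
  classical
  let φ : (∀ i, 𝓞 (K i)) →+* A := (e.symm : (∀ i, K i) →+* A).comp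
    (RingHom.pi fun i => (algebraMap (𝓞 (K i)) (K i)).comp (Pi.evalRingHom _ i))
  have hφ : Function.Injective φ := by
    intro x y hxy
    have := e.symm.injective hxy
    funext i
    exact RingOfIntegers.coe_injective (congrFun this i)
  have hord : IsZOrder A φ.range := by
    constructor
    · have : (⊤ : Submodule ℤ (∀ i, 𝓞 (K i))).FG := Module.Finite.fg_top
      have h := this.map φ.toAddMonoidHom.toIntLinearMap
      rw [Submodule.fg_iff_addSubgroup_fg] at h
      have heq : φ.range.toAddSubgroup =
          (Submodule.map φ.toAddMonoidHom.toIntLinearMap ⊤).toAddSubgroup := by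
        ext x
        simp only [Submodule.mem_toAddSubgroup, Submodule.mem_map, Submodule.mem_top, true_and]
        exact Iff.rfl
      unfold Subring.toAddSubgroup at heq ⊢
      exact heq ▸ h
    · rw [eq_top_iff]
      rintro a -
      have ha : a = ∑ i, e.symm (Pi.single i (e a i)) := by
        apply e.injective
        rw [map_sum]
        simp [Finset.univ_sum_single]
      rw [ha]
      refine Submodule.sum_mem _ fun i _ => ?_
      have halg : IsAlgebraic ℤ (e a i) := (IsFractionRing.isAlgebraic_iff ℤ ℚ (K i)).2
        (Algebra.IsAlgebraic.isAlgebraic (R := ℚ) (e a i))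
      obtain ⟨n, hn, hint⟩ := halg.exists_integral_multiple
      let y : 𝓞 (K i) := ⟨n • e a i, hint⟩
      have hy : φ (Pi.single i y) = n • e.symm (Pi.single i (e a i)) := by
        rw [← map_zsmul]
        apply e.injective
        simp only [φ, RingHom.comp_apply, RingHom.coe_coe, RingEquiv.apply_symm_apply]
        funext k
        by_cases hk : k = i
        · subst hk
          change algebraMap _ _ ((Pi.single k y : ∀ i, 𝓞 (K i)) k) =
            n • (Pi.single k (e a k) : ∀ i, K i) k
          rw [Pi.single_eq_same, Pi.single_eq_same]
          rfl
        · simp [hk]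
      have : e.symm (Pi.single i (e a i)) = ((n : ℚ)⁻¹) • φ (Pi.single i y) := by
        rw [hy, ← Int.cast_smul_eq_zsmul ℚ, smul_smul, inv_mul_cancel₀ (by exact_mod_cast hn), one_smul]
      rw [this]
      exact Submodule.smul_mem _ _ (Submodule.subset_span ⟨_, rfl⟩)
  let U : (∀ i, 𝓞 (K i))ˣ ≃* φ.rangeˣ := Units.mapEquiv (RingEquiv.ofLeftInverse (Function.leftInverse_invFun hφ)).toMulEquiv
  have hno : ∀ g : Multiplicative (ℤ × ℤ) →* (∀ i, (𝓞 (K i))ˣ), ¬ Function.Injective g := by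
    intro g hg
    refine hA _ hord ⟨(U.toMonoidHom.comp MulEquiv.piUnits.symm.toMonoidHom).comp g, ?_⟩
    exact U.injective.comp (MulEquiv.piUnits.symm.injective.comp hg)
  constructor
  · intro i
    by_contra hi
    obtain ⟨f, hf⟩ := hyp_L1 (K i) (by omega)
    refine hno ((MonoidHom.mulSingle (fun i => (𝓞 (K i))ˣ) i).comp f) ?_
    exact (Pi.mulSingle_injective i).comp hf
  · intro i j hi hj
    by_contra hij
    obtain ⟨u, hu⟩ := hyp_L2 (K i) (by omega)
    obtain ⟨v, hv⟩ := hyp_L2 (K j) (by omega)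
    let f1 := (MonoidHom.mulSingle (fun i => (𝓞 (K i))ˣ) i).comp ((zpowersHom _ u).comp (AddMonoidHom.toMultiplicative (AddMonoidHom.fst ℤ ℤ)))
    let f2 := (MonoidHom.mulSingle (fun i => (𝓞 (K i))ˣ) j).comp ((zpowersHom _ v).comp (AddMonoidHom.toMultiplicative (AddMonoidHom.snd ℤ ℤ)))
    apply hno (f1 * f2)
    rw [injective_iff_map_eq_one]
    intro x hx
    have h1 := congrFun hx i
    have h2 := congrFun hx j
    simp [f1, f2, hij, Ne.symm hij] at h1 h2
    exact Prod.ext (hu _ h1) (hv _ h2)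

noncomputable def hypChar {H K : Type*} [CommGroup H] [Field K] (p : MonoidAlgebra ℚ H →+* K) : H →* Kˣ :=
  MonoidHom.toHomUnits ((p : MonoidAlgebra ℚ H →* K).comp (MonoidAlgebra.of ℚ H))

theorem hypChar_apply {H K : Type*} [CommGroup H] [Field K] (p : MonoidAlgebra ℚ H →+* K) (h : H) :
    ((hypChar p h : Kˣ) : K) = p (MonoidAlgebra.of ℚ H h) := rfl

theorem hyp_gen {H K : Type*} [CommGroup H] [Finite H] [Field K] (χ : H →* Kˣ) :
    ∃ g, orderOf (χ g) = χ.ker.index ∧ ∀ h, ∃ k : ℕ, χ h = χ g ^ k := by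
  have hfin : Finite χ.range := Finite.of_surjective _ χ.rangeRestrict_surjective
  have hc : IsCyclic χ.range := inferInstance
  obtain ⟨⟨_, g, rfl⟩, hg⟩ := hc.exists_generator
  refine ⟨g, ?_, fun h => ?_⟩
  · rw [Subgroup.index_ker, ← orderOf_eq_card_of_forall_mem_zpowers hg]
    exact Subgroup.orderOf_coe (⟨χ g, MonoidHom.mem_range.2 ⟨g, rfl⟩⟩ : χ.range)
  · have := hg ⟨χ h, h, rfl⟩
    rw [← mem_powers_iff_mem_zpowers] at this
    obtain ⟨k, hk⟩ := this
    exact ⟨k, (congrArg Subtype.val hk).symm⟩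

theorem hyp_orderOf_char {H K : Type*} [CommGroup H] [Finite H] [Field K] (χ : H →* Kˣ) :
    orderOf χ = χ.ker.index := by
  obtain ⟨g, hg, h⟩ := hyp_gen χ
  rw [← hg]
  apply orderOf_eq_orderOf_iff.2
  intro n
  constructor
  · intro hn
    exact DFunLike.congr_fun hn g
  · intro hn
    ext x
    obtain ⟨k, hk⟩ := h x
    simp [hk, ← pow_mul]
    rw [mul_comm, pow_mul, ← Units.val_pow_eq_pow_val, hn]
    simp

theorem hyp_ker_eq {H K : Type*} [CommGroup H] [Finite H] [Field K] (χ ψ : H →* Kˣ)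
    (hk : χ.ker = ψ.ker) : ψ ∈ Subgroup.zpowers χ := by
  obtain ⟨g, hg, h⟩ := hyp_gen χ
  have hpr := IsPrimitiveRoot.orderOf (χ g)
  have hne : NeZero (orderOf (χ g)) := ⟨(χ.isOfFinOrder (isOfFinOrder_of_finite g)).orderOf_pos.ne'⟩
  have h1 : (ψ g) ^ orderOf (χ g) = 1 := by
    have : g ^ orderOf (χ g) ∈ ψ.ker := by
      rw [← hk, MonoidHom.mem_ker, map_pow, pow_orderOf_eq_one]
    rwa [MonoidHom.mem_ker, map_pow] at this
  obtain ⟨k, -, hk2⟩ := (IsPrimitiveRoot.coe_units_iff.2 hpr).eq_pow_of_pow_eq_one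
    (ξ := (ψ g : K)) (by rw [← Units.val_pow_eq_pow_val, h1, Units.val_one])
  have hk3 : χ g ^ k = ψ g := by ext; exact_mod_cast hk2
  refine (Subgroup.zpowers χ).mem_carrier.1 ?_
  suffices hs : χ ^ k = ψ by rw [← hs]; exact Subgroup.npow_mem_zpowers χ k
  ext x
  obtain ⟨j, hj⟩ := h x
  have : x * (g ^ j)⁻¹ ∈ ψ.ker := by
    rw [← hk, MonoidHom.mem_ker, map_mul, map_inv, map_pow, hj, mul_inv_cancel]
  rw [MonoidHom.mem_ker, map_mul, map_inv, map_pow, mul_inv_eq_one] at this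
  congr 1
  rw [MonoidHom.pow_apply, this, hj, ← hk3, ← pow_mul, ← pow_mul, mul_comm]

theorem hyp_numberField {H K : Type*} [CommGroup H] [Finite H] [Field K] [CharZero K]
    (p : MonoidAlgebra ℚ H →+* K) (hp : Function.Surjective p) : NumberField K := by
  have : Module.Finite ℚ (MonoidAlgebra ℚ H) := inferInstance
  have h2 : FiniteDimensional ℚ K := Module.Finite.of_surjective (p.toRatAlgHom).toLinearMap hp
  exact { }

theorem hyp_rank {H K : Type*} [CommGroup H] [Finite H] [Field K] [NumberField K]
    (p : MonoidAlgebra ℚ H →+* K) (hp : Function.Surjective p) :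
    Units.rank K = Nat.totient ((hypChar p).ker.index) / 2 - 1 := by
  obtain ⟨g, hg, h⟩ := hyp_gen (hypChar p)
  have hne : NeZero (orderOf (hypChar p g)) := ⟨((hypChar p).isOfFinOrder (isOfFinOrder_of_finite g)).orderOf_pos.ne'⟩
  rw [← hg]
  have hpr := IsPrimitiveRoot.orderOf (hypChar p g)
  set d := orderOf (hypChar p g) with hd
  have hcyc : IsCyclotomicExtension {d} ℚ K := by
    rw [IsCyclotomicExtension.iff_singleton]
    refine ⟨⟨_, IsPrimitiveRoot.coe_units_iff.2 hpr⟩, fun x => ?_⟩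
    obtain ⟨a, rfl⟩ := hp x
    induction a using MonoidAlgebra.induction_on with
    | of x =>
      apply Algebra.subset_adjoin
      obtain ⟨k, hk⟩ := h x
      change _ ^ d = 1
      rw [← hypChar_apply, hk, ← Units.val_pow_eq_pow_val, ← pow_mul, mul_comm, pow_mul, hpr.pow_eq_one]
      simp
    | add a b ha hb => rw [map_add]; exact add_mem ha hb
    | smul r a ha => 
      have : p (r • a) = r • p a := map_smul p.toRatAlgHom r a
      rw [this]; exact Subalgebra.smul_mem _ ha r
  have h1 := IsCyclotomicExtension.Rat.nrComplexPlaces_eq_totient_div_two d (K := K)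
  rw [Units.rank, InfinitePlace.card_eq_nrRealPlaces_add_nrComplexPlaces]
  by_cases h2 : 2 < d
  · have h3 := IsCyclotomicExtension.Rat.nrRealPlaces_eq_zero K h2
    rw [h1, h3, zero_add]
  · have h4 : Nat.totient d = 1 := by
      have h0 := hne.out
      have h12 : d = 1 ∨ d = 2 := by omega
      rcases h12 with h12 | h12 <;> rw [h12] <;> rfl
    have h5 := InfinitePlace.card_add_two_mul_card_eq_rank K
    have h6 := IsCyclotomicExtension.finrank (n := d) K (Polynomial.cyclotomic.irreducible_rat (Nat.pos_of_ne_zero hne.out))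
    omega

theorem hyp_ker_iff {H K : Type*} [CommGroup H] [Finite H] [Field K] [CharZero K]
    (p : MonoidAlgebra ℚ H →+* K) (hi : (hypChar p).ker.index = Nat.card H) (g : H)
    (hg : ∀ x, x ∈ Subgroup.zpowers g) (P : Polynomial ℚ) :
    p (Polynomial.aeval (MonoidAlgebra.of ℚ H g) P) = 0 ↔ Polynomial.cyclotomic (Nat.card H) ℚ ∣ P := by
  have hinj : Function.Injective (hypChar p) := by
    rw [← MonoidHom.ker_eq_bot_iff, ← Subgroup.card_eq_one]
    have := Subgroup.card_mul_index (hypChar p).ker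
    rw [hi] at this
    exact Nat.eq_of_mul_eq_mul_right Nat.card_pos (this.trans (one_mul _).symm)
  have hord : orderOf (hypChar p g) = Nat.card H := by
    rw [orderOf_injective _ hinj, orderOf_eq_card_of_forall_mem_zpowers hg]
  have hpr := IsPrimitiveRoot.coe_units_iff.2 (IsPrimitiveRoot.orderOf (hypChar p g))
  rw [hord] at hpr
  rw [Polynomial.cyclotomic_eq_minpoly_rat hpr Nat.card_pos, minpoly.dvd_iff]
  rw [hypChar_apply]
  have : p (Polynomial.aeval (MonoidAlgebra.of ℚ H g) P) = 
    Polynomial.aeval (p (MonoidAlgebra.of ℚ H g)) P := (Polynomial.aeval_algHom_apply p.toRatAlgHom _ _).symm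
  rw [this]

theorem hyp_poly_surj {H : Type*} [CommGroup H] [Finite H] (g : H)
    (hg : ∀ x, x ∈ Subgroup.zpowers g) (x : MonoidAlgebra ℚ H) :
    ∃ P : Polynomial ℚ, x = Polynomial.aeval (MonoidAlgebra.of ℚ H g) P := by
  induction x using MonoidAlgebra.induction_on with
  | of x =>
    have := hg x
    rw [← mem_powers_iff_mem_zpowers] at this
    obtain ⟨k, rfl⟩ := this
    exact ⟨Polynomial.X ^ k, by simp⟩
  | add a b ha hb =>
    obtain ⟨P, rfl⟩ := ha
    obtain ⟨Q, rfl⟩ := hb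
    exact ⟨P + Q, by simp⟩
  | smul r a ha =>
    obtain ⟨P, rfl⟩ := ha
    exact ⟨r • P, by simp⟩

theorem hyp_exponent {H K : Type*} [CommGroup H] [Finite H] [Field K] (χ : H →* Kˣ) :
    χ.ker.index ∣ Monoid.exponent H := by
  obtain ⟨g, hg, -⟩ := hyp_gen χ
  rw [← hg]
  exact (orderOf_map_dvd χ g).trans (Monoid.order_dvd_exponent g)

theorem hyp_zero_of_dvd (d n : ℕ) (hd : d ∣ n) (hn : n = 4 ∨ n = 6) : Nat.totient d / 2 - 1 = 0 := by
  have hdn : d ≤ n := Nat.le_of_dvd (by omega) hd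
  rcases hn with rfl | rfl <;> interval_cases d <;> revert hd <;> decide

theorem hyp_le_of_dvd (d n : ℕ) (hd : d ∣ n) (hn : n = 5 ∨ n = 8 ∨ n = 12) :
    Nat.totient d / 2 - 1 ≤ 1 ∧ (Nat.totient d / 2 - 1 ≠ 0 → d = n) := by
  have hdn : d ≤ n := Nat.le_of_dvd (by omega) hd
  rcases hn with rfl | rfl | rfl <;> interval_cases d <;> revert hd <;> decide

noncomputable instance hypField (R : Type*) [CommRing R] (i : MaximalSpectrum R) :
    Field (R ⧸ i.asIdeal) :=
  have := i.isMaximal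
  Ideal.Quotient.field i.asIdeal

theorem abelian_group_algebra_hyperbolic_iff
    (H : Type*) [CommGroup H] [Finite H] [Nontrivial H] :
    HasHyperbolicProperty (MonoidAlgebra ℚ H) ↔
      (Monoid.exponent H ∣ 4 ∨ Monoid.exponent H ∣ 6 ∨
        (IsCyclic H ∧ (Nat.card H = 5 ∨ Nat.card H = 8 ∨ Nat.card H = 12))) := by
  have hart : IsArtinianRing (MonoidAlgebra ℚ H) := IsArtinianRing.of_finite ℚ _
  have hne : NeZero (Nat.card H : ℚ) := ⟨by exact_mod_cast Nat.card_pos.ne'⟩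
  have hss : IsSemisimpleRing (MonoidAlgebra ℚ H) := inferInstance
  have hred : IsReduced (MonoidAlgebra ℚ H) := inferInstance
  have hfi : Fintype (MaximalSpectrum (MonoidAlgebra ℚ H)) := Fintype.ofFinite _
  have hcz : ∀ i : MaximalSpectrum (MonoidAlgebra ℚ H), CharZero (MonoidAlgebra ℚ H ⧸ i.asIdeal) :=
    fun i => algebraRat.charZero _
  have hnf : ∀ i : MaximalSpectrum (MonoidAlgebra ℚ H), NumberField (MonoidAlgebra ℚ H ⧸ i.asIdeal) :=
    fun i => hyp_numberField (Ideal.Quotient.mk i.asIdeal) Ideal.Quotient.mk_surjective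
  let e : MonoidAlgebra ℚ H ≃+* ∀ i : MaximalSpectrum (MonoidAlgebra ℚ H),
    MonoidAlgebra ℚ H ⧸ i.asIdeal := (IsArtinianRing.equivPi (MonoidAlgebra ℚ H)).toRingEquiv
  have hrank : ∀ i : MaximalSpectrum (MonoidAlgebra ℚ H), Units.rank (MonoidAlgebra ℚ H ⧸ i.asIdeal) =
      Nat.totient ((hypChar (Ideal.Quotient.mk i.asIdeal)).ker.index) / 2 - 1 :=
    fun i => hyp_rank (Ideal.Quotient.mk i.asIdeal) Ideal.Quotient.mk_surjective
  constructor
  · intro hA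
    obtain ⟨h1, h2⟩ := hyp_forward (fun i : MaximalSpectrum (MonoidAlgebra ℚ H) =>
      MonoidAlgebra ℚ H ⧸ i.asIdeal) e hA
    have hex : ∀ ψ : H →* ℂˣ, ∃ i : MaximalSpectrum (MonoidAlgebra ℚ H),
        (hypChar (Ideal.Quotient.mk i.asIdeal)).ker = ψ.ker := by
      intro ψ
      let q : MonoidAlgebra ℚ H →+* ℂ := (MonoidAlgebra.lift ℚ ℂ H ((Units.coeHom ℂ).comp ψ) : _ →ₐ[ℚ] ℂ)
      have hq : ∀ h, q (MonoidAlgebra.of ℚ H h) = ψ h := fun h => by simp [q]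
      have hprime : (RingHom.ker q).IsPrime := RingHom.ker_isPrime q
      obtain ⟨i, hi⟩ : ∃ i : MaximalSpectrum (MonoidAlgebra ℚ H), i.asIdeal = RingHom.ker q :=
        ⟨⟨RingHom.ker q, IsArtinianRing.isMaximal_of_isPrime _⟩, rfl⟩
      refine ⟨i, ?_⟩
      ext h
      rw [MonoidHom.mem_ker, MonoidHom.mem_ker, Units.ext_iff, hypChar_apply, Units.ext_iff, ← hq,
        Units.val_one, Units.val_one, ← map_one (Ideal.Quotient.mk _), Ideal.Quotient.eq,
        hi, RingHom.mem_ker, map_sub, map_one, sub_eq_zero]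
    obtain ⟨σ⟩ := CommGroup.monoidHom_mulEquiv_of_hasEnoughRootsOfUnity H ℂ
    have hr : ∀ (ψ : H →* ℂˣ) (i : MaximalSpectrum (MonoidAlgebra ℚ H)),
        (hypChar (Ideal.Quotient.mk i.asIdeal)).ker = ψ.ker →
        Units.rank (MonoidAlgebra ℚ H ⧸ i.asIdeal) = Nat.totient (orderOf ψ) / 2 - 1 := by
      intro ψ i hi
      rw [hrank, hi, hyp_orderOf_char]
    apply hyp_group
    · intro g
      obtain ⟨i, hi⟩ := hex (σ.symm g)
      have := h1 i
      rwa [hr _ i hi, MulEquiv.orderOf_eq] at this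
    · intro g h hg hh
      obtain ⟨i, hi⟩ := hex (σ.symm g)
      obtain ⟨j, hj⟩ := hex (σ.symm h)
      have hij := h2 i j (by rwa [hr _ i hi, MulEquiv.orderOf_eq])
        (by rwa [hr _ j hj, MulEquiv.orderOf_eq])
      subst hij
      obtain ⟨k, hk⟩ := hyp_ker_eq _ _ (hi.symm.trans hj)
      refine ⟨k, ?_⟩
      apply σ.symm.injective
      simpa using hk
  · intro hcond
    have : Nonempty (MaximalSpectrum (MonoidAlgebra ℚ H)) := inferInstance
    refine hyp_backward (fun i : MaximalSpectrum (MonoidAlgebra ℚ H) =>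
      MonoidAlgebra ℚ H ⧸ i.asIdeal) e.toRingHom e.injective ?_ ?_
    · intro i
      rw [hrank]
      have hd := hyp_exponent (hypChar (Ideal.Quotient.mk i.asIdeal))
      rcases hcond with h | h | ⟨-, h⟩
      · rw [hyp_zero_of_dvd _ 4 (hd.trans h) (by simp)]; omega
      · rw [hyp_zero_of_dvd _ 6 (hd.trans h) (by simp)]; omega
      · exact (hyp_le_of_dvd _ _ (Subgroup.index_dvd_card _) h).1
    · intro i j hi hj
      rw [hrank] at hi hj
      rcases hcond with h | h | ⟨hc, h⟩
      · exact absurd (hyp_zero_of_dvd _ 4 ((hyp_exponent _).trans h) (by simp)) hi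
      · exact absurd (hyp_zero_of_dvd _ 6 ((hyp_exponent _).trans h) (by simp)) hi
      · have hi' := (hyp_le_of_dvd _ _ (Subgroup.index_dvd_card _) h).2 hi
        have hj' := (hyp_le_of_dvd _ _ (Subgroup.index_dvd_card _) h).2 hj
        obtain ⟨g, hg⟩ := hc.exists_generator
        ext x
        obtain ⟨P, rfl⟩ := hyp_poly_surj g hg x
        rw [← Ideal.Quotient.eq_zero_iff_mem, ← Ideal.Quotient.eq_zero_iff_mem]
        exact (hyp_ker_iff _ hi' g hg P).trans (hyp_ker_iff _ hj' g hg P).symm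
end
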